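/- For every planar simple finite graph G, Hadwiger's conjecture holds for the total graph T(G), i.e., χ(T(G)) ≤ η(T(G)). -/

import Mathlib

open SimpleGraph

/-- The total graph `T(G)` of a simple graph `G`: its vertices are the vertices and edges
of `G`, with two elements adjacent iff they are adjacent or incident in `G`. -/
def totalGraph {V : Type*} (G : SimpleGraph V) : SimpleGraph (V ⊕ G.edgeSet) :=
  SimpleGraph.fromRel fun x y =>
    match x, y with
    | Sum.inl u, Sum.inl v => G.Adj u v
    | Sum.inl u, Sum.inr e => u ∈ (e : Sym2 V)
    | Sum.inr e, Sum.inl u => u ∈ (e : Sym2 V)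
    | Sum.inr e, Sum.inr f => ∃ u, u ∈ (e : Sym2 V) ∧ u ∈ (f : Sym2 V)

/-- `cv`, `ce` form a total coloring of `G`: adjacent vertices get distinct colors, edges
sharing an endpoint get distinct colors, and every edge gets a color distinct from the colors
of both of its endpoints. -/
def IsTotalColoring {V : Type*} (G : SimpleGraph V) (cv : V → ℕ) (ce : Sym2 V → ℕ) : Prop :=
  (∀ ⦃u v⦄, G.Adj u v → cv u ≠ cv v) ∧
  (∀ ⦃u v w⦄, G.Adj u v → G.Adj u w → v ≠ w → ce s(u, v) ≠ ce s(u, w)) ∧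
  (∀ ⦃u v⦄, G.Adj u v → ce s(u, v) ≠ cv u ∧ ce s(u, v) ≠ cv v)

/-- The total chromatic number `χ''(G)`: the least `k` such that `G` has a total coloring
using colors `0, …, k-1`. -/
noncomputable def totalChromaticNumber {V : Type*} (G : SimpleGraph V) : ℕ :=
  sInf {k | ∃ cv ce, IsTotalColoring G cv ce ∧ (∀ v, cv v < k) ∧ ∀ e ∈ G.edgeSet, ce e < k}

/-- `H` has a minor isomorphic to `K`: there are pairwise disjoint nonempty branch sets,
one for each vertex of `K`, each inducing a connected subgraph of `H`, with an edge of `H`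
between the branch sets of any two adjacent vertices of `K`. -/
def HasMinor {W U : Type*} (H : SimpleGraph W) (K : SimpleGraph U) : Prop :=
  ∃ B : U → Set W,
    (∀ i, (B i).Nonempty) ∧
    (Pairwise fun i j => Disjoint (B i) (B j)) ∧
    (∀ i, (H.induce (B i)).Connected) ∧
    ∀ ⦃i j⦄, K.Adj i j → ∃ u ∈ B i, ∃ v ∈ B j, H.Adj u v

/-- `H` has a clique minor of order `t` (a `K_t`-minor): `t` pairwise disjoint nonempty
vertex subsets, each inducing a connected subgraph, with an edge between every pair. -/
def HasCliqueMinor {W : Type*} (H : SimpleGraph W) (t : ℕ) : Prop :=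
  ∃ B : Fin t → Set W,
    (∀ i, (B i).Nonempty) ∧
    (Pairwise fun i j => Disjoint (B i) (B j)) ∧
    (∀ i, (H.induce (B i)).Connected) ∧
    Pairwise fun i j => ∃ u ∈ B i, ∃ v ∈ B j, H.Adj u v

/-- The Hadwiger number `η(H)`: the largest `t` such that `H` has a `K_t`-minor. -/
noncomputable def hadwigerNumber {W : Type*} (H : SimpleGraph W) : ℕ :=
  sSup {t | HasCliqueMinor H t}

/-- A graph is `c`-vertex-connected if it has more than `c` vertices and deleting any set of
fewer than `c` vertices leaves a connected graph. -/
def IsKConnected {V : Type*} [Fintype V] (c : ℕ) (G : SimpleGraph V) : Prop :=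
  c < Fintype.card V ∧
    ∀ S : Finset V, S.card < c → (G.induce ((S : Set V)ᶜ)).Connected

/-- `G` is planar (Wagner's characterization): `G` has neither a `K₅`-minor nor a
`K₃,₃`-minor. -/
def IsPlanar {V : Type*} (G : SimpleGraph V) : Prop :=
  ¬ HasMinor G (⊤ : SimpleGraph (Fin 5)) ∧
  ¬ HasMinor G (completeBipartiteGraph (Fin 3) (Fin 3))

/-- `c` is a proper edge coloring of `G`: edges sharing an endpoint get distinct colors. -/
def IsProperEdgeColoring {V : Type*} (G : SimpleGraph V) (c : Sym2 V → ℕ) : Prop :=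
  ∀ ⦃u v w⦄, G.Adj u v → G.Adj u w → v ≠ w → c s(u, v) ≠ c s(u, w)

/-- The chromatic index `χ'(G)`: the least `k` such that `G` has a proper edge coloring
using colors `0, …, k-1`. -/
noncomputable def chromaticIndex {V : Type*} (G : SimpleGraph V) : ℕ :=
  sInf {k | ∃ c : Sym2 V → ℕ, IsProperEdgeColoring G c ∧ ∀ e ∈ G.edgeSet, c e < k}

/-- `G` is `k`-edge-choosable: for every assignment of a list of `k` colors to each edge
there is a proper edge coloring choosing each edge's color from its list. -/
def EdgeChoosable {V : Type*} (G : SimpleGraph V) (k : ℕ) : Prop :=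
  ∀ L : Sym2 V → Finset ℕ, (∀ e ∈ G.edgeSet, (L e).card = k) →
    ∃ c : Sym2 V → ℕ, IsProperEdgeColoring G c ∧ ∀ e ∈ G.edgeSet, c e ∈ L e

/-- The edge choosability `ch'(G)`: the least `k` such that `G` is `k`-edge-choosable. -/
noncomputable def edgeChoosability {V : Type*} (G : SimpleGraph V) : ℕ :=
  sInf {k | EdgeChoosable G k}

/-- The subdivision of `H`: every edge `uv` is replaced by a path `u – w_{uv} – v` through
a new vertex `w_{uv}` corresponding to that edge. -/
def subdivision {V : Type*} (H : SimpleGraph V) : SimpleGraph (V ⊕ H.edgeSet) :=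
  SimpleGraph.fromRel fun x y =>
    match x, y with
    | Sum.inl u, Sum.inr e => u ∈ (e : Sym2 V)
    | _, _ => False

/-- The square `G²` of `G`: two distinct vertices are adjacent iff their distance in `G`
is at most `2`, i.e. they are adjacent or have a common neighbour. -/
def squareGraph {V : Type*} (G : SimpleGraph V) : SimpleGraph V :=
  SimpleGraph.fromRel fun u v => G.Adj u v ∨ ∃ w, G.Adj u w ∧ G.Adj w v

section

open scoped Classical

variable {V : Type*}

/-- Cut form of connectedness of the subgraph induced on `A`. -/
def Linked (G : SimpleGraph V) (A : Set V) : Prop :=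
  A.Nonempty ∧ ∀ X ⊆ A, X.Nonempty → X ≠ A → ∃ x ∈ X, ∃ y ∈ A, y ∉ X ∧ G.Adj x y

theorem Linked.induce_connected {G : SimpleGraph V} {A : Set V} (h : Linked G A) :
    (G.induce A).Connected := by
  obtain ⟨⟨a, ha⟩, hA⟩ := h
  rw [SimpleGraph.connected_iff_exists_forall_reachable]
  refine ⟨⟨a, ha⟩, fun ⟨b, hb⟩ => ?_⟩
  let X : Set V := {x | ∃ hx : x ∈ A, (G.induce A).Reachable ⟨a, ha⟩ ⟨x, hx⟩}
  by_cases hX : X = A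
  · have : b ∈ X := hX ▸ hb
    exact this.2
  · obtain ⟨x, ⟨hx, hr⟩, y, hy, hyX, hxy⟩ :=
      hA X (fun x hx => hx.1) ⟨a, ha, SimpleGraph.Reachable.refl _⟩ hX
    refine absurd ⟨hy, hr.trans (SimpleGraph.Adj.reachable ?_)⟩ hyX
    exact hxy

theorem linked_singleton (G : SimpleGraph V) (a : V) : Linked G {a} := by
  refine ⟨⟨a, rfl⟩, fun X hX hne hXa => ?_⟩
  obtain ⟨x, hx⟩ := hne
  exact absurd (Set.Subset.antisymm hX (by rintro _ rfl; exact (hX hx : x = _) ▸ hx)) hXa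

theorem Linked.of_dominating {G : SimpleGraph V} {A B : Set V} (hA : Linked G A) (hAB : A ⊆ B)
    (h : ∀ b ∈ B, b ∉ A → ∃ a ∈ A, G.Adj b a) : Linked G B := by
  refine ⟨hA.1.mono hAB, fun X hX hne hXB => ?_⟩
  by_cases h1 : A ⊆ X
  · obtain ⟨b, hb, hbX⟩ : ∃ b ∈ B, b ∉ X := by
      by_contra! hc
      exact hXB (Set.Subset.antisymm hX hc)
    obtain ⟨a, ha, hba⟩ := h b hb fun hbA => hbX (h1 hbA)
    exact ⟨a, h1 ha, b, hb, hbX, hba.symm⟩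
  · by_cases h2 : (X ∩ A).Nonempty
    · obtain ⟨x, hx, y, hy, hyX, hxy⟩ := hA.2 (X ∩ A) Set.inter_subset_right h2
        fun hc => h1 fun a ha => (hc.symm ▸ ha : a ∈ X ∩ A).1
      exact ⟨x, hx.1, y, hAB hy, fun hc => hyX ⟨hc, hy⟩, hxy⟩
    · obtain ⟨x, hx⟩ := hne
      have hxA : x ∉ A := fun hc => h2 ⟨x, hx, hc⟩
      obtain ⟨a, ha, hxa⟩ := h x (hX hx) hxA
      exact ⟨x, hx, a, hAB ha, fun hc => h2 ⟨a, hc, ha⟩, hxa⟩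

/-- A `K_t`-minor of `G` all of whose branch sets lie in `S`. -/
def CliqueMinorIn (G : SimpleGraph V) (S : Finset V) (t : ℕ) : Prop :=
  ∃ B : Fin t → Set V, (∀ i, B i ⊆ S) ∧ (∀ i, Linked G (B i)) ∧
    (Pairwise fun i j => Disjoint (B i) (B j)) ∧
    Pairwise fun i j => ∃ u ∈ B i, ∃ v ∈ B j, G.Adj u v

theorem Linked.mono {G H : SimpleGraph V} (h : G ≤ H) {A : Set V} (hA : Linked G A) :
    Linked H A :=
  ⟨hA.1, fun X h1 h2 h3 => by
    obtain ⟨x, hx, y, hy, hyX, hxy⟩ := hA.2 X h1 h2 h3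
    exact ⟨x, hx, y, hy, hyX, h hxy⟩⟩

theorem CliqueMinorIn.mono {G H : SimpleGraph V} (h : G ≤ H) {S T : Finset V} (hST : S ⊆ T)
    {t : ℕ} (hG : CliqueMinorIn G S t) : CliqueMinorIn H T t := by
  obtain ⟨B, h1, h2, h3, h4⟩ := hG
  refine ⟨B, fun i => (h1 i).trans (by exact_mod_cast hST), fun i => (h2 i).mono h, h3,
    fun i j hij => ?_⟩
  obtain ⟨u, hu, v, hv, huv⟩ := h4 hij
  exact ⟨u, hu, v, hv, h huv⟩

theorem CliqueMinorIn.cone {G : SimpleGraph V} {S N : Finset V} {x : V} {t : ℕ}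
    (hN : N ⊆ S) (hx : x ∈ S) (hxN : ∀ y ∈ N, G.Adj x y) (h : CliqueMinorIn G N t) :
    CliqueMinorIn G S (t + 1) := by
  obtain ⟨B, h1, h2, h3, h4⟩ := h
  have hdis : ∀ i, x ∉ B i := fun i hi => (hxN x (h1 i hi)).ne rfl
  have hadj : ∀ i, ∃ v ∈ B i, G.Adj x v := fun i => by
    obtain ⟨v, hv⟩ := (h2 i).1
    exact ⟨v, hv, hxN v (h1 i hv)⟩
  refine ⟨Fin.cases {x} B, fun i => ?_, fun i => ?_, fun i j hij => ?_, fun i j hij => ?_⟩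
  · induction i using Fin.cases with
    | zero => simpa using hx
    | succ i => exact (h1 i).trans (by exact_mod_cast hN)
  · induction i using Fin.cases with
    | zero => exact linked_singleton G x
    | succ i => exact h2 i
  · induction i using Fin.cases with
    | zero =>
      induction j using Fin.cases with
      | zero => exact absurd rfl hij
      | succ j => simpa using hdis j
    | succ i =>
      induction j using Fin.cases with
      | zero => simpa using hdis i
      | succ j => exact h3 fun hc => hij (congrArg _ hc)
  · induction i using Fin.cases with
    | zero =>
      induction j using Fin.cases with
      | zero => exact absurd rfl hij
      | succ j => simpa using hadj j
    | succ i =>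
      induction j using Fin.cases with
      | zero =>
        obtain ⟨v, hv, hxv⟩ := hadj i
        exact ⟨v, hv, x, rfl, hxv.symm⟩
      | succ j => exact h4 fun hc => hij (congrArg _ hc)

/-- Contraction of the vertex `x` into the vertex `a`: every neighbour of `x` becomes a
neighbour of `a`. -/
def contractInto (G : SimpleGraph V) (x a : V) : SimpleGraph V where
  Adj p q := p ≠ q ∧ (G.Adj p q ∨ (p = a ∧ G.Adj x q) ∨ (q = a ∧ G.Adj x p))
  symm := ⟨by
    rintro p q ⟨h, h1 | h1 | h1⟩
    · exact ⟨h.symm, Or.inl h1.symm⟩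
    · exact ⟨h.symm, Or.inr (Or.inr h1)⟩
    · exact ⟨h.symm, Or.inr (Or.inl h1)⟩⟩
  loopless := ⟨fun p h => h.1 rfl⟩

theorem linked_of_contractInto {G : SimpleGraph V} {x a : V} (hxa : G.Adj x a) {A : Set V}
    (hx : x ∉ A) (hA : Linked (contractInto G x a) A) :
    Linked G (if a ∈ A then insert x A else A) := by
  split_ifs with ha
  · refine ⟨⟨x, Or.inl rfl⟩, fun X hX hne hXA => ?_⟩
    by_cases h1 : x ∈ X <;> by_cases h2 : a ∈ X
    · obtain ⟨p, hp, q, hq, hqX, hpq, h⟩ := hA.2 (X \ {x})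
        (fun y hy => (hX hy.1).resolve_left hy.2) ⟨a, h2, hxa.ne'⟩
        (fun hc => hXA (Set.Subset.antisymm hX (by
          rintro y (rfl | hy)
          · exact h1
          · exact (hc.symm ▸ hy : y ∈ X \ {x}).1)))
      have hqx : q ≠ x := fun hc => hx (hc ▸ hq)
      have hqX' : q ∉ X := fun hc => hqX ⟨hc, hqx⟩
      rcases h with h | ⟨-, h⟩ | ⟨rfl, -⟩
      · exact ⟨p, hp.1, q, Or.inr hq, hqX', h⟩
      · exact ⟨x, h1, q, Or.inr hq, hqX', h⟩
      · exact absurd h2 hqX'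
    · exact ⟨x, h1, a, Or.inr ha, h2, hxa⟩
    · exact ⟨a, h2, x, Or.inl rfl, h1, hxa.symm⟩
    · have hXs : X ⊆ A := fun y hy => (hX hy).resolve_left fun hc => h1 (hc ▸ hy)
      obtain ⟨p, hp, q, hq, hqX, hpq, h⟩ := hA.2 X hXs hne fun hc => h2 (hc ▸ ha)
      rcases h with h | ⟨rfl, -⟩ | ⟨-, h⟩
      · exact ⟨p, hp, q, Or.inr hq, hqX, h⟩
      · exact absurd hp h2
      · exact ⟨p, hp, x, Or.inl rfl, h1, h.symm⟩
  · refine ⟨hA.1, fun X hX hne hXA => ?_⟩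
    obtain ⟨p, hp, q, hq, hqX, hpq, h⟩ := hA.2 X hX hne hXA
    rcases h with h | ⟨rfl, -⟩ | ⟨rfl, -⟩
    · exact ⟨p, hp, q, hq, hqX, h⟩
    · exact absurd (hX hp) ha
    · exact absurd hq ha

theorem CliqueMinorIn.of_contractInto {G : SimpleGraph V} {x a : V} (hxa : G.Adj x a)
    {S : Finset V} {t : ℕ} (hx : x ∈ S) (h : CliqueMinorIn (contractInto G x a) (S.erase x) t) :
    CliqueMinorIn G S t := by
  obtain ⟨B, h1, h2, h3, h4⟩ := h
  have hxB : ∀ i, x ∉ B i := fun i hi => by simpa using h1 i hi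
  have hsub : ∀ i, B i ⊆ if a ∈ B i then insert x (B i) else B i := fun i => by
    split_ifs
    · exact Set.subset_insert _ _
    · exact subset_rfl
  have hmem : ∀ i, a ∈ B i → x ∈ if a ∈ B i then insert x (B i) else B i := fun i hi => by
    simp [hi]
  refine ⟨fun i => if a ∈ B i then insert x (B i) else B i, fun i y hy => ?_,
    fun i => linked_of_contractInto hxa (hxB i) (h2 i), fun i j hij => ?_, fun i j hij => ?_⟩
  · have h5 : y ∈ B i → y ∈ S := fun hy => Finset.mem_of_mem_erase (h1 i hy)
    simp only at hy
    split_ifs at hy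
    · rcases hy with rfl | hy
      · exact hx
      · exact h5 hy
    · exact h5 hy
  · have hd := Set.disjoint_left.1 (h3 hij)
    refine Set.disjoint_left.2 fun y hy hy' => ?_
    simp only at hy hy'
    split_ifs at hy hy' with ha ha' ha'
    · exact hd ha ha'
    · rcases hy with rfl | hy
      · exact hxB _ hy'
      · exact hd hy hy'
    · rcases hy' with rfl | hy'
      · exact hxB _ hy
      · exact hd hy hy'
    · exact hd hy hy'
  · obtain ⟨u, hu, v, hv, -, h | ⟨rfl, h⟩ | ⟨rfl, h⟩⟩ := h4 hij
    · exact ⟨u, hsub i hu, v, hsub j hv, h⟩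
    · exact ⟨x, hmem i hu, v, hsub j hv, h⟩
    · exact ⟨u, hsub i hu, x, hmem j hv, h.symm⟩

theorem CliqueMinorIn.of_pairwise_adj {G : SimpleGraph V} {S : Finset V}
    (h : ∀ x ∈ S, ∀ y ∈ S, x ≠ y → G.Adj x y) : CliqueMinorIn G S S.card := by
  let f := S.equivFin.symm
  refine ⟨fun i => {(f i : V)}, fun i => by simp, fun i => linked_singleton G _,
    fun i j hij => ?_, fun i j hij => ⟨_, rfl, _, rfl, h _ (f i).2 _ (f j).2 ?_⟩⟩
  · simpa [Subtype.coe_inj] using hij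
  · simpa [Subtype.coe_inj] using hij

/-- The number of neighbours of `x` inside `S`. -/
noncomputable def degIn (G : SimpleGraph V) (S : Finset V) (x : V) : ℕ :=
  (S.filter (G.Adj x)).card

/-- Twice the number of edges inside `S`. -/
noncomputable def degSum (G : SimpleGraph V) (S : Finset V) : ℕ :=
  ∑ x ∈ S, degIn G S x

theorem degIn_erase (G : SimpleGraph V) {S : Finset V} {x : V} (hx : x ∈ S) (y : V) :
    degIn G S y = degIn G (S.erase x) y + if G.Adj x y then 1 else 0 := by
  unfold degIn
  rw [Finset.filter_erase]
  split_ifs with h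
  · rw [Finset.card_erase_add_one]
    simp [hx, h.symm]
  · rw [Finset.erase_eq_of_notMem, add_zero]
    simp only [Finset.mem_filter, not_and]
    exact fun _ hc => h hc.symm

theorem degSum_erase (G : SimpleGraph V) {S : Finset V} {x : V} (hx : x ∈ S) :
    degSum G S = degSum G (S.erase x) + 2 * degIn G S x := by
  unfold degSum
  rw [← Finset.add_sum_erase S _ hx, Finset.sum_congr rfl fun y _ => degIn_erase G hx y,
    Finset.sum_add_distrib, ← Finset.card_filter]
  have : ((S.erase x).filter fun y => G.Adj x y).card = degIn G S x := by
    unfold degIn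
    rw [Finset.filter_erase, Finset.erase_eq_of_notMem (by simp)]
  omega

theorem degSum_contractInto (G : SimpleGraph V) {S : Finset V} {x a : V}
    (ha : a ∈ S) {R : Finset V} (hRS : R ⊆ S) (haR : a ∉ R)
    (hR : ∀ b ∈ R, G.Adj x b ∧ ¬ G.Adj a b) :
    degSum G S + 2 * R.card ≤ degSum (contractInto G x a) S := by
  unfold degSum
  have key : ∀ y ∈ S, degIn G S y + ((if y = a then R.card else 0) + if y ∈ R then 1 else 0) ≤
      degIn (contractInto G x a) S y := by
    intro y hy
    unfold degIn
    by_cases hya : y = a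
    · subst hya
      rw [if_pos rfl, if_neg haR, add_zero, ← Finset.card_union_of_disjoint]
      · refine Finset.card_le_card fun z hz => ?_
        rw [Finset.mem_union, Finset.mem_filter] at hz
        rw [Finset.mem_filter]
        rcases hz with hz | hz
        · exact ⟨hz.1, hz.2.ne, Or.inl hz.2⟩
        · exact ⟨hRS hz, fun hc => haR (hc ▸ hz), Or.inr (Or.inl ⟨rfl, (hR z hz).1⟩)⟩
      · rw [Finset.disjoint_left]
        intro z hz hz'
        exact (hR z hz').2 (Finset.mem_filter.1 hz).2
    · rw [if_neg hya, zero_add]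
      split_ifs with hyR
      · rw [← Finset.card_insert_of_notMem (a := a)]
        · refine Finset.card_le_card fun z hz => ?_
          rw [Finset.mem_insert, Finset.mem_filter] at hz
          rw [Finset.mem_filter]
          rcases hz with rfl | hz
          · exact ⟨ha, hya, Or.inr (Or.inr ⟨rfl, (hR y hyR).1⟩)⟩
          · exact ⟨hz.1, hz.2.ne, Or.inl hz.2⟩
        · exact fun hc => (hR y hyR).2 (Finset.mem_filter.1 hc).2.symm
      · refine Finset.card_le_card fun z hz => ?_
        rw [Finset.mem_filter] at hz ⊢
        exact ⟨hz.1, hz.2.ne, Or.inl hz.2⟩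
  calc _ = ∑ y ∈ S, (degIn G S y + ((if y = a then R.card else 0) + if y ∈ R then 1 else 0)) := by
        rw [Finset.sum_add_distrib, Finset.sum_add_distrib, Finset.sum_ite_eq' S a,
          if_pos ha, ← Finset.card_filter, Finset.filter_mem_eq_inter,
          Finset.inter_eq_right.2 hRS]
        ring
    _ ≤ _ := Finset.sum_le_sum key

theorem degSum_deleteEdges (G : SimpleGraph V) (S : Finset V) (p q : V) :
    degSum G S ≤ degSum (G.deleteEdges {s(p, q)}) S + 2 := by
  obtain ⟨H, hH⟩ : ∃ H, H = G.deleteEdges {s(p, q)} := ⟨_, rfl⟩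
  have hadj : ∀ y z, G.Adj y z → H.Adj y z ∨ (y = p ∧ z = q) ∨ (y = q ∧ z = p) := by
    intro y z h
    rw [hH, SimpleGraph.deleteEdges_adj, Set.mem_singleton_iff, Sym2.eq_iff]
    tauto
  rw [← hH]
  unfold degSum
  have key : ∀ y ∈ S, degIn G S y ≤ degIn H S y +
      ((if y = p then 1 else 0) + if y = q then 1 else 0) := by
    intro y _
    unfold degIn
    by_cases hp : y = p
    · have : (S.filter (G.Adj y)).card ≤
          (insert q (S.filter (H.Adj y))).card := by
        refine Finset.card_le_card fun z hz => ?_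
        simp only [Finset.mem_filter, Finset.mem_insert] at hz ⊢
        grind
      have h2 := Finset.card_insert_le q (S.filter (H.Adj y))
      rw [if_pos hp]
      omega
    · by_cases hq : y = q
      · have : (S.filter (G.Adj y)).card ≤
            (insert p (S.filter (H.Adj y))).card := by
          refine Finset.card_le_card fun z hz => ?_
          simp only [Finset.mem_filter, Finset.mem_insert] at hz ⊢
          grind
        have h2 := Finset.card_insert_le p (S.filter (H.Adj y))
        rw [if_pos hq]
        omega
      · rw [if_neg hp, if_neg hq]
        refine Finset.card_le_card fun z hz => ?_
        simp only [Finset.mem_filter] at hz ⊢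
        grind
  refine (Finset.sum_le_sum key).trans ?_
  rw [Finset.sum_add_distrib, Finset.sum_add_distrib, Finset.sum_ite_eq' S p,
    Finset.sum_ite_eq' S q]
  split_ifs <;> omega

theorem degSum_deleteEdges_lt {G : SimpleGraph V} {S : Finset V} {p q : V} (hp : p ∈ S)
    (hq : q ∈ S) (hpq : G.Adj p q) : degSum (G.deleteEdges {s(p, q)}) S < degSum G S := by
  unfold degSum degIn
  refine Finset.sum_lt_sum (fun y _ => Finset.card_le_card fun z hz => ?_)
    ⟨p, hp, Finset.card_lt_card ((Finset.ssubset_iff_of_subset fun z hz => ?_).2 ⟨q, ?_⟩)⟩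
  · simp only [Finset.mem_filter, SimpleGraph.deleteEdges_adj] at hz ⊢
    exact ⟨hz.1, hz.2.1⟩
  · simp only [Finset.mem_filter, SimpleGraph.deleteEdges_adj] at hz ⊢
    exact ⟨hz.1, hz.2.1⟩
  · simp [hq, hpq]

theorem degIn_lt_card {G : SimpleGraph V} {S : Finset V} {x : V} (hx : x ∈ S) :
    degIn G S x < S.card :=
  Finset.card_lt_card ((Finset.ssubset_iff_of_subset (Finset.filter_subset _ _)).2
    ⟨x, hx, by simp⟩)

theorem exists_degIn_lt {G : SimpleGraph V} {S : Finset V} {m : ℕ}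
    (h : degSum G S < m * S.card) : ∃ x ∈ S, degIn G S x < m := by
  by_contra! hc
  have := Finset.card_nsmul_le_sum S (degIn G S) m hc
  rw [smul_eq_mul, mul_comm] at this
  exact absurd h (not_lt.2 this)

theorem exists_adj_of_degSum_pos {G : SimpleGraph V} {S : Finset V} (h : 0 < degSum G S) :
    ∃ p ∈ S, ∃ q ∈ S, G.Adj p q := by
  obtain ⟨p, hp, h⟩ := Finset.exists_ne_zero_of_sum_ne_zero h.ne'
  obtain ⟨q, hq⟩ := Finset.card_ne_zero.1 h
  rw [Finset.mem_filter] at hq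
  exact ⟨p, hp, q, hq⟩

theorem degSum_le (G : SimpleGraph V) (S : Finset V) : degSum G S ≤ S.card * (S.card - 1) := by
  refine (Finset.sum_le_card_nsmul S _ (S.card - 1) fun x hx => ?_).trans_eq (smul_eq_mul _ _)
  have := degIn_lt_card (G := G) hx
  omega

/-- If contracting `x` into one of its neighbours loses more than `l` edges, whichever
neighbour is chosen, then every neighbour `a` of `x` in `S` has many neighbours among the
neighbours of `x`. -/
theorem le_degIn_filter_adj {G : SimpleGraph V} {S : Finset V} {x : V} (hx : x ∈ S) {l : ℕ}
    (h : ∀ a ∈ S, G.Adj x a →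
      degSum (contractInto G x a) (S.erase x) + 2 * l < degSum G S)
    {a : V} (ha : a ∈ S) (hxa : G.Adj x a) : l ≤ degIn G (S.filter (G.Adj x)) a := by
  have h1 := h a ha hxa
  let N := S.filter (G.Adj x)
  have h2 := degSum_contractInto G (S := S.erase x) (x := x) (a := a)
    (Finset.mem_erase.2 ⟨hxa.ne', ha⟩) (R := (N.erase a).filter fun b => ¬ G.Adj a b)
    (fun b hb => by
      simp only [N, Finset.mem_filter, Finset.mem_erase] at hb ⊢
      exact ⟨hb.1.2.2.ne', hb.1.2.1⟩) (by simp)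
    (fun b hb => by
      simp only [N, Finset.mem_filter, Finset.mem_erase] at hb
      exact ⟨hb.1.2.2, hb.2⟩)
  have h3 := degSum_erase G hx
  have h4 := Finset.card_filter_add_card_filter_not (s := N.erase a) (G.Adj a)
  have haN : a ∈ N := Finset.mem_filter.2 ⟨ha, hxa⟩
  have h5 : ((N.erase a).filter (G.Adj a)).card = degIn G N a := by
    unfold degIn
    rw [Finset.filter_erase, Finset.erase_eq_of_notMem (by simp)]
  have h6 := Finset.card_erase_add_one haN
  have h7 : N.card = degIn G S x := rfl
  change l ≤ degIn G N a
  omega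

theorem even_degSum (G : SimpleGraph V) (S : Finset V) : Even (degSum G S) := by
  induction h : S.card generalizing S with
  | zero =>
    rw [Finset.card_eq_zero] at h
    simp [h, degSum]
  | succ n ih =>
    obtain ⟨x, hx⟩ := Finset.card_pos.1 (h ▸ Nat.succ_pos n : 0 < S.card)
    rw [degSum_erase G hx]
    exact (ih _ (by rw [Finset.card_erase_of_mem hx, h]; rfl)).add (even_two_mul _)

/-- Induction scheme for extremal functions of clique minors: one may assume that the number of
edges is exactly at the threshold, and that no contraction keeps the graph above it. -/
theorem cliqueMinorIn_induction {t a b c : ℕ}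
    (step : ∀ (G : SimpleGraph V) (S : Finset V), c ≤ S.card → degSum G S + b = 2 * a * S.card →
      (∀ x ∈ S, degIn G S x ≤ a → S.card ≠ c → CliqueMinorIn G S t) →
      (∀ x ∈ S, ∀ y ∈ S, G.Adj x y → S.card ≠ c → degSum G S ≤
        degSum (contractInto G x y) (S.erase x) + 2 * a → CliqueMinorIn G S t) →
      CliqueMinorIn G S t) (hb : b < 2 * a * c) (hb2 : Even b) (n : ℕ) :
    ∀ (G : SimpleGraph V) (S : Finset V), S.card = n → c ≤ S.card →
      2 * a * S.card ≤ degSum G S + b → CliqueMinorIn G S t := by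
  induction n using Nat.strong_induction_on with
  | _ n ih =>
  intro G S hn hc hd
  induction hm : degSum G S using Nat.strong_induction_on generalizing G with
  | _ m ihm =>
  subst hm
  have hac : 2 * a * c ≤ 2 * a * S.card := Nat.mul_le_mul_left _ hc
  by_cases heq : degSum G S + b = 2 * a * S.card
  · refine step G S hc heq (fun x hx hxa hne => ?_) fun x hx y hy hxy hne hxyd => ?_
    · have hcard := Finset.card_erase_add_one hx
      have he := degSum_erase G hx
      rw [← hcard, mul_add] at hd
      exact (ih _ (by omega) G (S.erase x) rfl (by omega) (by omega)).mono le_rfl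
        (Finset.erase_subset _ _)
    · have hcard := Finset.card_erase_add_one hx
      rw [← hcard, mul_add] at hd
      exact (ih _ (by omega) (contractInto G x y) (S.erase x) rfl (by omega)
        (by omega)).of_contractInto hxy hx
  · obtain ⟨p, hp, q, hq, hpq⟩ := exists_adj_of_degSum_pos (G := G) (S := S) (by omega)
    have e1 := degSum_deleteEdges G S p q
    have e2 := degSum_deleteEdges_lt hp hq hpq
    obtain ⟨u, hu⟩ := even_degSum G S
    obtain ⟨w, hw⟩ := hb2
    have h2 : 2 * a * S.card = 2 * (a * S.card) := by ring
    exact (ihm _ e2 (G.deleteEdges {s(p, q)}) (by omega) rfl).mono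
      (SimpleGraph.deleteEdges_le _) subset_rfl

theorem cliqueMinorIn_four (G : SimpleGraph V) (S : Finset V) (h2 : 2 ≤ S.card)
    (hd : 4 * S.card ≤ degSum G S + 4) : CliqueMinorIn G S 4 := by
  refine cliqueMinorIn_induction (a := 2) (b := 4) (c := 2) ?_ (by norm_num) (by decide)
    _ G S rfl h2 hd
  intro G S h2 hd herase hcontr
  have hle := degSum_le G S
  have h3 : S.card ≠ 2 := by
    intro hc
    rw [hc] at hle hd
    omega
  obtain ⟨x, hx, hx4⟩ := exists_degIn_lt (G := G) (S := S) (m := 4) (by omega)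
  by_cases hx2 : degIn G S x ≤ 2
  · exact herase x hx hx2 h3
  by_cases hcon : ∀ a ∈ S, G.Adj x a →
      degSum (contractInto G x a) (S.erase x) + 2 * 2 < degSum G S
  · have hN : (S.filter (G.Adj x)).card = 3 := by
      change degIn G S x = 3
      omega
    have hK : CliqueMinorIn G (S.filter (G.Adj x)) 3 := by
      rw [← hN]
      refine CliqueMinorIn.of_pairwise_adj fun a ha b hb hab => ?_
      rw [Finset.mem_filter] at ha
      have h5 := le_degIn_filter_adj hx hcon ha.1 ha.2
      have ha' : a ∈ S.filter (G.Adj x) := Finset.mem_filter.2 ha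
      have h6 : (S.filter (G.Adj x)).filter (G.Adj a) = (S.filter (G.Adj x)).erase a := by
        refine Finset.eq_of_subset_of_card_le (fun z hz => ?_) ?_
        · rw [Finset.mem_filter] at hz
          exact Finset.mem_erase.2 ⟨hz.2.ne', hz.1⟩
        · rw [Finset.card_erase_of_mem ha', hN]
          exact h5
      have : b ∈ (S.filter (G.Adj x)).erase a := Finset.mem_erase.2 ⟨hab.symm, hb⟩
      rw [← h6] at this
      exact (Finset.mem_filter.1 this).2
    exact hK.cone (Finset.filter_subset _ _) hx fun y hy => (Finset.mem_filter.1 hy).2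
  · push Not at hcon
    obtain ⟨a, ha, hxa, hle2⟩ := hcon
    exact hcontr x hx a ha hxa h3 (by omega)

theorem cliqueMinorIn_five (G : SimpleGraph V) (S : Finset V) (h3 : 3 ≤ S.card)
    (hd : 6 * S.card ≤ degSum G S + 10) : CliqueMinorIn G S 5 := by
  refine cliqueMinorIn_induction (a := 3) (b := 10) (c := 3) ?_ (by norm_num) (by decide)
    _ G S rfl h3 hd
  intro G S h3 hd herase hcontr
  have hle := degSum_le G S
  have h3 : S.card ≠ 3 := by
    intro hc
    rw [hc] at hle hd
    omega
  obtain ⟨x, hx, hx6⟩ := exists_degIn_lt (G := G) (S := S) (m := 6) (by omega)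
  by_cases hx3 : degIn G S x ≤ 3
  · exact herase x hx hx3 h3
  by_cases hcon : ∀ a ∈ S, G.Adj x a →
      degSum (contractInto G x a) (S.erase x) + 2 * 3 < degSum G S
  · have hN : (S.filter (G.Adj x)).card = degIn G S x := rfl
    have hK : CliqueMinorIn G (S.filter (G.Adj x)) 4 := by
      obtain ⟨u, hu⟩ := even_degSum G (S.filter (G.Adj x))
      have h7 : (S.filter (G.Adj x)).card • 3 ≤ degSum G (S.filter (G.Adj x)) :=
        Finset.card_nsmul_le_sum _ _ _ fun a ha => by
          rw [Finset.mem_filter] at ha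
          exact le_degIn_filter_adj hx hcon ha.1 ha.2
      rw [smul_eq_mul] at h7
      exact cliqueMinorIn_four G _ (by omega) (by omega)
    exact hK.cone (Finset.filter_subset _ _) hx fun y hy => (Finset.mem_filter.1 hy).2
  · push Not at hcon
    obtain ⟨a, ha, hxa, hle2⟩ := hcon
    exact hcontr x hx a ha hxa h3 (by omega)

theorem exists_ne_of_card_lt {ι : Type*} {m : ℕ} (T : Finset ι) (φ : ι → Fin m)
    (h : T.card < m) : ∃ c, ∀ y ∈ T, φ y ≠ c := by
  have h1 : (T.image φ).card < (Finset.univ : Finset (Fin m)).card := by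
    rw [Finset.card_univ, Fintype.card_fin]
    exact Finset.card_image_le.trans_lt h
  obtain ⟨c, -, hc⟩ := Finset.exists_mem_notMem_of_card_lt_card h1
  exact ⟨c, fun y hy hyc => hc (Finset.mem_image.2 ⟨y, hy, hyc⟩)⟩

/-- `φ` properly colours the subgraph of `G` induced on `S`. -/
def ProperOn {α : Type*} (G : SimpleGraph V) (S : Finset V) (φ : V → α) : Prop :=
  ∀ ⦃x⦄, x ∈ S → ∀ ⦃y⦄, y ∈ S → G.Adj x y → φ x ≠ φ y

theorem ProperOn.update {α : Type*} {G : SimpleGraph V} {S : Finset V} {φ : V → α} {x : V}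
    (h : ProperOn G (S.erase x) φ) {c : α} (hc : ∀ y ∈ S, G.Adj x y → φ y ≠ c) :
    ProperOn G S (Function.update φ x c) := by
  intro y hy z hz hyz
  by_cases hyx : y = x
  · subst hyx
    rw [Function.update_self, Function.update_of_ne hyz.ne']
    exact (hc z hz hyz).symm
  · by_cases hzx : z = x
    · subst hzx
      rw [Function.update_self, Function.update_of_ne hyx]
      exact hc y hy hyz.symm
    · rw [Function.update_of_ne hyx, Function.update_of_ne hzx]
      exact h (Finset.mem_erase.2 ⟨hyx, hy⟩) (Finset.mem_erase.2 ⟨hzx, hz⟩) hyz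

theorem exists_properOn_five (n : ℕ) : ∀ (G : SimpleGraph V) (S : Finset V), S.card = n →
    ¬ CliqueMinorIn G S 5 → ∃ φ : V → Fin 5, ProperOn G S φ := by
  induction n using Nat.strong_induction_on with
  | _ n ih =>
  intro G S hn hG
  obtain rfl | hne := S.eq_empty_or_nonempty
  · exact ⟨fun _ => 0, fun x hx => absurd hx (Finset.notMem_empty x)⟩
  obtain ⟨x, hx, hx5⟩ : ∃ x ∈ S, degIn G S x ≤ 5 := by
    by_cases h3 : 3 ≤ S.card
    · have := mt (cliqueMinorIn_five G S h3) hG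
      obtain ⟨x, hx, h⟩ := exists_degIn_lt (G := G) (S := S) (m := 6) (by omega)
      exact ⟨x, hx, by omega⟩
    · obtain ⟨x, hx⟩ := hne
      have := degIn_lt_card (G := G) hx
      exact ⟨x, hx, by omega⟩
  have hcard := Finset.card_erase_add_one hx
  by_cases hx4 : degIn G S x < 5
  · obtain ⟨φ, hφ⟩ := ih _ (by omega) G (S.erase x) rfl
      fun hc => hG (hc.mono le_rfl (Finset.erase_subset _ _))
    obtain ⟨c, hc⟩ := exists_ne_of_card_lt (S.filter (G.Adj x)) φ hx4
    exact ⟨_, hφ.update fun y hy hxy => hc y (Finset.mem_filter.2 ⟨hy, hxy⟩)⟩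
  · have hN : (S.filter (G.Adj x)).card = 5 := by
      change degIn G S x = 5
      omega
    obtain ⟨a, b, ha, hb, hab, hnab⟩ : ∃ a b, a ∈ S.filter (G.Adj x) ∧
        b ∈ S.filter (G.Adj x) ∧ a ≠ b ∧ ¬ G.Adj a b := by
      by_contra! hc
      refine hG (CliqueMinorIn.mono le_rfl (Finset.filter_subset (G.Adj x) S) ?_)
      rw [← hN]
      exact CliqueMinorIn.of_pairwise_adj fun p hp q hq => hc p q hp hq
    rw [Finset.mem_filter] at ha hb
    have hba : (contractInto G x a).Adj b a := ⟨hab.symm, Or.inr (Or.inr ⟨rfl, hb.2⟩)⟩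
    have hbS : b ∈ S.erase x := Finset.mem_erase.2 ⟨hb.2.ne', hb.1⟩
    have haS : a ∈ (S.erase x).erase b :=
      Finset.mem_erase.2 ⟨hab, Finset.mem_erase.2 ⟨ha.2.ne', ha.1⟩⟩
    have hcard2 := Finset.card_erase_add_one hbS
    obtain ⟨φ, hφ⟩ := ih _ (by omega) (contractInto (contractInto G x a) b a)
      ((S.erase x).erase b) rfl
      fun hc => hG ((hc.of_contractInto hba hbS).of_contractInto ha.2 hx)
    have h1 : ProperOn G (S.erase x) (Function.update φ b (φ a)) := by
      refine ProperOn.update (fun y hy z hz hyz => hφ hy hz ?_) fun y hy hby => ?_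
      · exact ⟨hyz.ne, Or.inl ⟨hyz.ne, Or.inl hyz⟩⟩
      · have hya : y ≠ a := fun hc => hnab (hc ▸ hby).symm
        refine hφ (Finset.mem_erase.2 ⟨hby.ne', hy⟩) haS
          ⟨hya, Or.inr (Or.inr ⟨rfl, hby.ne, Or.inl hby⟩)⟩
    obtain ⟨c, hc⟩ := exists_ne_of_card_lt ((S.filter (G.Adj x)).erase b)
      (Function.update φ b (φ a)) (by
        rw [Finset.card_erase_of_mem (Finset.mem_filter.2 hb), hN]
        norm_num)
    refine ⟨_, h1.update (c := c) fun y hy hxy => ?_⟩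
    by_cases hyb : y = b
    · subst hyb
      have := hc a (Finset.mem_erase.2 ⟨hab, Finset.mem_filter.2 ha⟩)
      rw [Function.update_self]
      rwa [Function.update_of_ne hab] at this
    · exact hc y (Finset.mem_erase.2 ⟨hyb, Finset.mem_filter.2 ⟨hy, hxy⟩⟩)

theorem exists_five_coloring [Fintype V] {G : SimpleGraph V}
    (h : ¬ HasMinor G (⊤ : SimpleGraph (Fin 5))) :
    ∃ φ : V → Fin 5, ∀ ⦃x y⦄, G.Adj x y → φ x ≠ φ y := by
  obtain ⟨φ, hφ⟩ := exists_properOn_five _ G Finset.univ rfl fun ⟨B, _, h2, h3, h4⟩ =>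
    h ⟨B, fun i => (h2 i).1, h3, fun i => (h2 i).induce_connected, fun i j hij => h4 hij.ne⟩
  exact ⟨φ, fun x y hxy => hφ (Finset.mem_univ x) (Finset.mem_univ y) hxy⟩

/-- No edge of `G` at `y` has colour `i`. -/
def Missing (G : SimpleGraph V) (c : Sym2 V → ℕ) (y : V) (i : ℕ) : Prop :=
  ∀ w, G.Adj y w → c s(y, w) ≠ i

/-- Exchange of the colours `i` and `j` on the edges touching `K`. -/
noncomputable def kempeSwap (c : Sym2 V → ℕ) (K : Set V) (i j : ℕ) (e : Sym2 V) : ℕ :=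
  if ∃ u ∈ e, u ∈ K then Equiv.swap i j (c e) else c e

theorem kempeSwap_apply {G : SimpleGraph V} {c : Sym2 V → ℕ} {K : Set V} {i j : ℕ}
    (hK : ∀ u ∈ K, ∀ v, G.Adj u v → c s(u, v) = i ∨ c s(u, v) = j → v ∈ K) {u v : V}
    (huv : G.Adj u v) :
    kempeSwap c K i j s(u, v) = if u ∈ K then Equiv.swap i j (c s(u, v)) else c s(u, v) := by
  unfold kempeSwap
  by_cases hu : u ∈ K
  · rw [if_pos hu, if_pos ⟨u, Sym2.mem_mk_left u v, hu⟩]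
  · rw [if_neg hu]
    by_cases hv : v ∈ K
    · rw [if_pos ⟨v, Sym2.mem_mk_right u v, hv⟩]
      have h := hK v hv u huv.symm
      rw [Sym2.eq_swap] at h
      exact Equiv.swap_apply_of_ne_of_ne (fun hc => hu (h (Or.inl hc))) fun hc => hu (h (Or.inr hc))
    · rw [if_neg]
      rintro ⟨w, hw, hwK⟩
      rcases Sym2.mem_iff.1 hw with rfl | rfl
      exacts [hu hwK, hv hwK]

theorem kempeSwap_proper {G : SimpleGraph V} {c : Sym2 V → ℕ} (hc : IsProperEdgeColoring G c)
    {K : Set V} {i j : ℕ}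
    (hK : ∀ u ∈ K, ∀ v, G.Adj u v → c s(u, v) = i ∨ c s(u, v) = j → v ∈ K) :
    IsProperEdgeColoring G (kempeSwap c K i j) := by
  intro u v w huv huw hvw
  rw [kempeSwap_apply hK huv, kempeSwap_apply hK huw]
  split_ifs
  · exact fun h => hc huv huw hvw ((Equiv.swap i j).injective h)
  · exact hc huv huw hvw

theorem missing_kempeSwap {G : SimpleGraph V} {c : Sym2 V → ℕ} {K : Set V} {i j : ℕ}
    (hK : ∀ u ∈ K, ∀ v, G.Adj u v → c s(u, v) = i ∨ c s(u, v) = j → v ∈ K) {y : V} {S : Finset ℕ}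
    (hS : ∀ k ∈ S, Missing G c y k) :
    ∀ k ∈ (if y ∈ K then S.image (Equiv.swap i j) else S), Missing G (kempeSwap c K i j) y k := by
  intro k hk w hyw
  rw [kempeSwap_apply hK hyw]
  split_ifs at hk ⊢
  · obtain ⟨k', hk', rfl⟩ := Finset.mem_image.1 hk
    exact fun h => hS k' hk' w hyw ((Equiv.swap i j).injective h)
  · exact hS k hk w hyw

/-- A Kempe component contains at most two vertices missing one of its two colours. -/
theorem exists_kempe_closed [Fintype V] {G : SimpleGraph V} {c : Sym2 V → ℕ}
    (hc : IsProperEdgeColoring G c) (i j : ℕ) {X : Finset V} (hX : ∀ y ∈ X, Missing G c y j)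
    (h3 : 3 ≤ X.card) : ∃ K : Set V,
      (∀ u ∈ K, ∀ v, G.Adj u v → c s(u, v) = i ∨ c s(u, v) = j → v ∈ K) ∧
      (∃ y ∈ X, y ∈ K) ∧ ∃ y ∈ X, y ∉ K := by
  obtain ⟨y, hy⟩ := Finset.card_pos.1 (by omega : 0 < X.card)
  obtain ⟨H, hH⟩ : ∃ H : SimpleGraph V,
      ∀ u v, H.Adj u v ↔ G.Adj u v ∧ (c s(u, v) = i ∨ c s(u, v) = j) :=
    ⟨⟨fun u v => G.Adj u v ∧ (c s(u, v) = i ∨ c s(u, v) = j),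
      ⟨fun u v h => ⟨h.1.symm, by rw [Sym2.eq_swap]; exact h.2⟩⟩, ⟨fun u h => h.1.ne rfl⟩⟩,
      fun u v => Iff.rfl⟩
  obtain ⟨K, hK, hmax⟩ := Finset.exists_max_image
    (Finset.univ.filter fun K : Finset V => y ∈ K ∧ 2 * K.card ≤ degSum H K + 2) Finset.card
    ⟨{y}, by simp⟩
  simp only [Finset.mem_filter, Finset.mem_univ, true_and] at hK hmax
  refine ⟨K, fun u hu v huv hcol => ?_, ⟨y, hy, hK.1⟩, ?_⟩
  · by_contra hv
    have hv' : v ∉ K := hv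
    have hvi : v ∈ insert v K := Finset.mem_insert_self v K
    have h1 := degSum_erase H hvi
    rw [Finset.erase_insert hv'] at h1
    have h2 : 0 < degIn H (insert v K) v := Finset.card_pos.2
      ⟨u, Finset.mem_filter.2 ⟨Finset.mem_insert_of_mem hu, ((hH u v).2 ⟨huv, hcol⟩).symm⟩⟩
    have h3 := hmax (insert v K) ⟨Finset.mem_insert_of_mem hK.1, by
      rw [Finset.card_insert_of_notMem hv']
      omega⟩
    rw [Finset.card_insert_of_notMem hv'] at h3
    omega
  · by_contra! hsub
    have hdeg : ∀ x ∈ K, degIn H K x + (if x ∈ X then 1 else 0) ≤ 2 := by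
      intro x _
      have hinj : Set.InjOn (fun w => c s(x, w)) (K.filter (H.Adj x)) := by
        intro w hw w' hw' heq
        simp only [Finset.coe_filter, Set.mem_ofPred_eq, hH] at hw hw'
        by_contra hne
        exact hc hw.2.1 hw'.2.1 hne heq
      split_ifs with hxX
      · have := Finset.card_le_card_of_injOn (s := K.filter (H.Adj x)) (t := {i})
          (fun w => c s(x, w)) (fun w hw => by
            simp only [Finset.coe_filter, Set.mem_ofPred_eq, hH] at hw
            exact Finset.mem_singleton.2 (hw.2.2.resolve_right (hX x hxX w hw.2.1))) hinj
        rw [Finset.card_singleton] at this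
        unfold degIn
        omega
      · have := Finset.card_le_card_of_injOn (s := K.filter (H.Adj x)) (t := {i, j})
          (fun w => c s(x, w)) (fun w hw => by
            simp only [Finset.coe_filter, Set.mem_ofPred_eq, hH] at hw
            simpa using hw.2.2) hinj
        exact this.trans Finset.card_le_two
    have h1 := Finset.sum_le_card_nsmul K _ 2 hdeg
    rw [Finset.sum_add_distrib, ← Finset.card_filter, Finset.filter_mem_eq_inter,
      Finset.inter_eq_right.2 hsub, smul_eq_mul] at h1
    change degSum H K + X.card ≤ _ at h1
    omega

theorem exists_missing_injOn [Fintype V] (G : SimpleGraph V) (n : ℕ) :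
    ∀ (C : Finset ℕ) (N : Finset V) (c : Sym2 V → ℕ) (S : V → Finset ℕ), C.card = n →
      IsProperEdgeColoring G c → N.card ≤ C.card → (∀ y ∈ N, S y ⊆ C) →
      (∀ y ∈ N, ∀ i ∈ S y, Missing G c y i) →
      (N = ∅ ∨ ∃ y ∈ N, (S y).card = 1 ∧ ∀ z ∈ N, z ≠ y → (S z).card = 2) →
      ∃ c' : Sym2 V → ℕ, IsProperEdgeColoring G c' ∧
        (∀ e, c' e = c e ∨ c e ∈ C ∧ c' e ∈ C) ∧
        ∃ f : V → ℕ, Set.InjOn f N ∧ ∀ y ∈ N, f y ∈ C ∧ Missing G c' y (f y) := by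
  induction n with
  | zero =>
    intro C N c S hn hc hNC _ _ _
    have : N = ∅ := Finset.card_eq_zero.1 (by omega)
    subst this
    exact ⟨c, hc, fun e => Or.inl rfl, fun _ => 0, by simp, by simp⟩
  | succ n ih =>
  intro C N c S hn hc hNC hSC hS hcard
  obtain rfl | ⟨y₀, hy₀, h1, h2⟩ := hcard
  · exact ⟨c, hc, fun e => Or.inl rfl, fun _ => 0, by simp, by simp⟩
  induction hm : ∑ i ∈ C, (N.filter fun y => i ∈ S y).card ^ 2 using Nat.strong_induction_on
    generalizing c S with
  | _ m ihm =>
  by_cases hone : ∃ i ∈ C, (N.filter fun y => i ∈ S y).card = 1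
  · obtain ⟨i, hi, hi1⟩ := hone
    obtain ⟨y, hy⟩ := Finset.card_eq_one.1 hi1
    have hy' : ∀ z, z ∈ N ∧ i ∈ S z ↔ z = y := fun z => by
      simpa using Finset.ext_iff.1 hy z
    have hyN := ((hy' y).2 rfl).1
    have hiy := ((hy' y).2 rfl).2
    have hCc := Finset.card_erase_add_one hi
    have hNc := Finset.card_erase_add_one hyN
    have key : ∃ S' : V → Finset ℕ, (∀ z ∈ N.erase y, S' z ⊆ S z) ∧ (N.erase y = ∅ ∨
        ∃ w ∈ N.erase y, (S' w).card = 1 ∧ ∀ z ∈ N.erase y, z ≠ w → (S' z).card = 2) := by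
      obtain hemp | ⟨z, hz⟩ := (N.erase y).eq_empty_or_nonempty
      · exact ⟨S, fun z _ => subset_rfl, Or.inl hemp⟩
      by_cases hyy : y = y₀
      · subst hyy
        have hz2 := h2 z (Finset.mem_of_mem_erase hz) (Finset.ne_of_mem_erase hz)
        obtain ⟨k, hk⟩ := Finset.card_pos.1 (by omega : 0 < (S z).card)
        refine ⟨Function.update S z {k}, fun w hw => ?_, Or.inr ⟨z, hz, by simp, fun w hw hwz => ?_⟩⟩
        · by_cases hwz : w = z
          · subst hwz
            simpa using hk
          · rw [Function.update_of_ne hwz]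
        · rw [Function.update_of_ne hwz]
          exact h2 w (Finset.mem_of_mem_erase hw) (Finset.ne_of_mem_erase hw)
      · exact ⟨S, fun z _ => subset_rfl, Or.inr ⟨y₀, Finset.mem_erase.2 ⟨Ne.symm hyy, hy₀⟩, h1,
          fun z hz => h2 z (Finset.mem_of_mem_erase hz)⟩⟩
    obtain ⟨S', hS', hcard'⟩ := key
    obtain ⟨c', hc', hcc', f, hf, hfC⟩ := ih (C.erase i) (N.erase y) c S' (by omega) hc (by omega)
      (fun z hz k hk => Finset.mem_erase.2 ⟨fun hki => Finset.ne_of_mem_erase hz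
        ((hy' z).1 ⟨Finset.mem_of_mem_erase hz, hki ▸ hS' z hz hk⟩),
        hSC z (Finset.mem_of_mem_erase hz) (hS' z hz hk)⟩)
      (fun z hz k hk => hS z (Finset.mem_of_mem_erase hz) k (hS' z hz hk)) hcard'
    refine ⟨c', hc', fun e => (hcc' e).imp_right fun h =>
      ⟨Finset.mem_of_mem_erase h.1, Finset.mem_of_mem_erase h.2⟩, Function.update f y i, ?_, ?_⟩
    · intro p hp q hq hpq
      by_cases hpy : p = y <;> by_cases hqy : q = y
      · rw [hpy, hqy]
      · subst hpy
        rw [Function.update_self, Function.update_of_ne hqy] at hpq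
        have := (hfC q (Finset.mem_erase.2 ⟨hqy, hq⟩)).1
        exact absurd hpq.symm (Finset.ne_of_mem_erase this)
      · subst hqy
        rw [Function.update_self, Function.update_of_ne hpy] at hpq
        have := (hfC p (Finset.mem_erase.2 ⟨hpy, hp⟩)).1
        exact absurd hpq (Finset.ne_of_mem_erase this)
      · rw [Function.update_of_ne hqy, Function.update_of_ne hpy] at hpq
        exact hf (Finset.mem_erase.2 ⟨hpy, hp⟩) (Finset.mem_erase.2 ⟨hqy, hq⟩) hpq
    · intro z hz
      by_cases hzy : z = y
      · subst hzy
        rw [Function.update_self]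
        refine ⟨hi, fun w hw hcw => ?_⟩
        rcases hcc' s(z, w) with h | h
        · exact hS z hz i hiy w hw (h ▸ hcw)
        · exact absurd hcw (Finset.ne_of_mem_erase h.2)
      · rw [Function.update_of_ne hzy]
        have := hfC z (Finset.mem_erase.2 ⟨hzy, hz⟩)
        exact ⟨Finset.mem_of_mem_erase this.1, this.2⟩
  push Not at hone
  have hsum : ∑ i ∈ C, (N.filter fun y => i ∈ S y).card + 1 = 2 * N.card := by
    have e1 : ∑ i ∈ C, (N.filter fun y => i ∈ S y).card = ∑ y ∈ N, (S y).card := by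
      refine (Finset.sum_card_bipartiteAbove_eq_sum_card_bipartiteBelow (s := C) (t := N)
        fun i y => i ∈ S y).trans ?_
      refine Finset.sum_congr rfl fun y hy => congrArg _ ?_
      ext k
      simp only [Finset.mem_filter, Finset.bipartiteBelow]
      exact ⟨fun h => h.2, fun h => ⟨hSC y hy h, h⟩⟩
    rw [e1, ← Finset.add_sum_erase N _ hy₀, h1, Finset.sum_congr rfl fun y hy =>
      h2 y (Finset.mem_of_mem_erase hy) (Finset.ne_of_mem_erase hy), Finset.sum_const,
      smul_eq_mul, ← Finset.card_erase_add_one hy₀]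
    ring
  obtain ⟨i, hi, hi0⟩ : ∃ i ∈ C, (N.filter fun y => i ∈ S y).card = 0 := by
    by_contra! hc0
    have := Finset.card_nsmul_le_sum C (fun i => (N.filter fun y => i ∈ S y).card) 2
      fun i hi => by
        have := hone i hi
        have := hc0 i hi
        omega
    rw [smul_eq_mul] at this
    omega
  obtain ⟨j, hj, hjodd⟩ : ∃ j ∈ C, ¬ 2 ∣ (N.filter fun y => j ∈ S y).card := by
    by_contra! hc0
    have := Finset.dvd_sum hc0
    omega
  have hj3 : 3 ≤ (N.filter fun y => j ∈ S y).card := by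
    have := hone j hj
    omega
  have hij : i ≠ j := by
    rintro rfl
    omega
  obtain ⟨K, hK, ⟨y, hyX, hyK⟩, z, hzX, hzK⟩ := exists_kempe_closed hc i j
    (X := N.filter fun y => j ∈ S y)
    (fun y hy => hS y (Finset.mem_filter.1 hy).1 j (Finset.mem_filter.1 hy).2) hj3
  let S' : V → Finset ℕ := fun y => if y ∈ K then (S y).image (Equiv.swap i j) else S y
  have hcardS : ∀ y, (S' y).card = (S y).card := by
    intro y
    simp only [S']
    split_ifs
    · exact Finset.card_image_of_injective _ (Equiv.injective _)
    · rfl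
  have hmemS : ∀ y k, k ∈ S' y ↔ (if y ∈ K then Equiv.swap i j k else k) ∈ S y := by
    intro y k
    simp only [S']
    split_ifs
    · rw [Finset.mem_image]
      constructor
      · rintro ⟨k', hk', rfl⟩
        rwa [Equiv.swap_apply_self]
      · exact fun h => ⟨_, h, Equiv.swap_apply_self i j k⟩
    · rfl
  have hswapC : ∀ k, k ∈ C → Equiv.swap i j k ∈ C := by
    intro k hk
    rw [Equiv.swap_apply_def]
    split_ifs <;> assumption
  have hlt : ∑ k ∈ C, (N.filter fun y => k ∈ S' y).card ^ 2 < m := by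
    have hjC : j ∈ C.erase i := Finset.mem_erase.2 ⟨hij.symm, hj⟩
    have hX := Finset.card_filter_add_card_filter_not (s := N.filter fun y => j ∈ S y) (· ∈ K)
    have hi0' : ∀ y ∈ N, i ∉ S y := fun y hy hiy => by
      have : y ∈ N.filter fun y => i ∈ S y := Finset.mem_filter.2 ⟨hy, hiy⟩
      rw [Finset.card_eq_zero.1 hi0] at this
      exact absurd this (Finset.notMem_empty y)
    have ei : (N.filter fun y => i ∈ S' y) = (N.filter fun y => j ∈ S y).filter (· ∈ K) := by
      ext y
      simp only [Finset.mem_filter, hmemS]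
      split_ifs with h
      · simp [h]
      · simp only [h, and_false, iff_false, not_and]
        exact hi0' y
    have ej : (N.filter fun y => j ∈ S' y) = (N.filter fun y => j ∈ S y).filter (¬ · ∈ K) := by
      ext y
      simp only [Finset.mem_filter, hmemS]
      split_ifs with h
      · simp only [h, not_true, and_false, iff_false, not_and, Equiv.swap_apply_right]
        exact hi0' y
      · simp [h]
    have er : ∀ k ∈ (C.erase i).erase j,
        (N.filter fun y => k ∈ S' y).card ^ 2 = (N.filter fun y => k ∈ S y).card ^ 2 := by
      intro k hk
      rw [Finset.mem_erase, Finset.mem_erase] at hk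
      simp only [hmemS, Equiv.swap_apply_of_ne_of_ne hk.2.1 hk.1, ite_self]
    rw [← hm, ← Finset.add_sum_erase C _ hi, ← Finset.add_sum_erase _ _ hjC,
      ← Finset.add_sum_erase C _ hi, ← Finset.add_sum_erase _ _ hjC,
      Finset.sum_congr rfl er, ei, ej, hi0, ← hX]
    have p1 : 0 < ((N.filter fun y => j ∈ S y).filter (· ∈ K)).card :=
      Finset.card_pos.2 ⟨y, Finset.mem_filter.2 ⟨hyX, hyK⟩⟩
    have p2 : 0 < ((N.filter fun y => j ∈ S y).filter (¬ · ∈ K)).card :=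
      Finset.card_pos.2 ⟨z, Finset.mem_filter.2 ⟨hzX, hzK⟩⟩
    nlinarith [mul_pos p1 p2]
  obtain ⟨c', hc', hcc', f, hf, hfC⟩ := ihm _ hlt (kempeSwap c K i j) S' (kempeSwap_proper hc hK)
    (fun y hy k hk => by
      rw [hmemS] at hk
      have := hSC y hy hk
      split_ifs at this
      · simpa using hswapC _ this
      · exact this)
    (fun y hy => missing_kempeSwap hK (hS y hy)) (by rw [hcardS, h1])
    (fun z hz hzy => by rw [hcardS, h2 z hz hzy]) rfl
  refine ⟨c', hc', fun e => ?_, f, hf, hfC⟩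
  have hsw : kempeSwap c K i j e = c e ∨ c e ∈ C ∧ kempeSwap c K i j e ∈ C := by
    unfold kempeSwap
    split_ifs
    · rw [Equiv.swap_apply_def]
      split_ifs with h h'
      · exact Or.inr ⟨h ▸ hi, hj⟩
      · exact Or.inr ⟨h' ▸ hj, hi⟩
      · exact Or.inl rfl
    · exact Or.inl rfl
  have := hcc' e
  grind

/-- The subgraph of `G` formed by the edges with both endpoints in `T`, on all vertices. -/
def within (G : SimpleGraph V) (T : Set V) : SimpleGraph V where
  Adj p q := G.Adj p q ∧ p ∈ T ∧ q ∈ T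
  symm := ⟨fun _ _ h => ⟨h.1.symm, h.2.2, h.2.1⟩⟩
  loopless := ⟨fun _ h => h.1.ne rfl⟩

/-- Assign the value `f y` to each edge `vy` and `c e` to the edges avoiding `v`. -/
noncomputable def recolorAt (c : Sym2 V → ℕ) (v : V) (f : V → ℕ) (e : Sym2 V) : ℕ :=
  if h : v ∈ e then f (Sym2.Mem.other h) else c e

theorem recolorAt_left (c : Sym2 V → ℕ) (v : V) (f : V → ℕ) (y : V) :
    recolorAt c v f s(v, y) = f y := by
  have h : v ∈ s(v, y) := Sym2.mem_mk_left v y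
  unfold recolorAt
  rw [dif_pos h, Sym2.congr_right.1 (Sym2.other_spec h)]

theorem recolorAt_right (c : Sym2 V → ℕ) (v : V) (f : V → ℕ) (y : V) :
    recolorAt c v f s(y, v) = f y := by
  rw [Sym2.eq_swap, recolorAt_left]

theorem recolorAt_of_ne (c : Sym2 V → ℕ) {v : V} (f : V → ℕ) {x y : V} (hx : x ≠ v)
    (hy : y ≠ v) : recolorAt c v f s(x, y) = c s(x, y) := by
  unfold recolorAt
  rw [dif_neg]
  rw [Sym2.mem_iff]
  rintro (h | h)
  exacts [hx h.symm, hy h.symm]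

/-- Vizing's theorem. -/
theorem exists_properEdgeColoring [Fintype V] (G : SimpleGraph V) {D : ℕ}
    (hD : ∀ v, degIn G Finset.univ v ≤ D) :
    ∃ c : Sym2 V → ℕ, IsProperEdgeColoring G c ∧ ∀ u v, G.Adj u v → c s(u, v) ≤ D := by
  have key : ∀ T : Finset V, ∃ c : Sym2 V → ℕ, IsProperEdgeColoring (within G T) c ∧
      ∀ u v, (within G T).Adj u v → c s(u, v) ∈ Finset.range (D + 1) := by
    intro T
    induction T using Finset.induction_on with
    | empty => exact ⟨fun _ => 0, fun u v w h => by simpa using h.2.1, fun u v h => by simp⟩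
    | insert v T hv ih =>
      obtain ⟨c, hc, hcD⟩ := ih
      let N := T.filter (G.Adj v)
      have hND : N.card ≤ D := (Finset.card_le_card fun z hz => by
        rw [Finset.mem_filter] at hz ⊢
        exact ⟨Finset.mem_univ z, hz.2⟩).trans (hD v)
      have hmiss : ∀ y ∈ N, 2 ≤ ((Finset.range (D + 1)).filter
          (Missing (within G T) c y)).card := by
        intro y hy
        rw [Finset.mem_filter] at hy
        have h1 := Finset.card_filter_add_card_filter_not (s := Finset.range (D + 1))
          (Missing (within G T) c y)
        have h2 : ((Finset.range (D + 1)).filter (¬ Missing (within G T) c y ·)).card ≤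
            (T.filter (G.Adj y)).card := by
          refine (Finset.card_le_card (t := (T.filter (G.Adj y)).image fun w => c s(y, w))
            fun i hi => ?_).trans Finset.card_image_le
          rw [Finset.mem_filter] at hi
          unfold Missing at hi
          push Not at hi
          obtain ⟨-, w, hw, rfl⟩ := hi
          exact Finset.mem_image.2 ⟨w, Finset.mem_filter.2 ⟨hw.2.2, hw.1⟩, rfl⟩
        have h3 : (T.filter (G.Adj y)).card < degIn G Finset.univ y := by
          refine Finset.card_lt_card ((Finset.ssubset_iff_of_subset fun z hz => ?_).2 ⟨v, ?_, ?_⟩)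
          · rw [Finset.mem_filter] at hz ⊢
            exact ⟨Finset.mem_univ z, hz.2⟩
          · simp [hy.2.symm]
          · simp [hv]
        have := hD y
        rw [Finset.card_range] at h1
        omega
      have hS2 : ∀ y, ∃ S : Finset ℕ, y ∈ N →
          S ⊆ (Finset.range (D + 1)).filter (Missing (within G T) c y) ∧ S.card = 2 := by
        intro y
        by_cases hy : y ∈ N
        · obtain ⟨S, h1, h2⟩ := Finset.exists_subset_card_eq (hmiss y hy)
          exact ⟨S, fun _ => ⟨h1, h2⟩⟩
        · exact ⟨∅, fun h => absurd h hy⟩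
      choose S hS using hS2
      have key : ∃ S' : V → Finset ℕ, (∀ y ∈ N, S' y ⊆ S y) ∧ (N = ∅ ∨
          ∃ y ∈ N, (S' y).card = 1 ∧ ∀ z ∈ N, z ≠ y → (S' z).card = 2) := by
        obtain hemp | ⟨y, hy⟩ := N.eq_empty_or_nonempty
        · exact ⟨S, fun _ _ => subset_rfl, Or.inl hemp⟩
        · obtain ⟨k, hk⟩ := Finset.card_pos.1 (by rw [(hS y hy).2]; norm_num : 0 < (S y).card)
          refine ⟨Function.update S y {k}, fun w hw => ?_, Or.inr ⟨y, hy, by simp, fun z hz hzy => ?_⟩⟩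
          · by_cases hwy : w = y
            · subst hwy
              simpa using hk
            · rw [Function.update_of_ne hwy]
          · rw [Function.update_of_ne hzy]
            exact (hS z hz).2
      obtain ⟨S', hS', hcard⟩ := key
      have hsub : ∀ y ∈ N, ∀ i ∈ S' y, i ∈ Finset.range (D + 1) ∧ Missing (within G T) c y i :=
        fun y hy i hi => Finset.mem_filter.1 ((hS y hy).1 (hS' y hy hi))
      obtain ⟨c', hc', hcc', f, hf, hfC⟩ := exists_missing_injOn (within G T) _
        (Finset.range (D + 1)) N c S' rfl hc (by rw [Finset.card_range]; omega)
        (fun y hy i hi => (hsub y hy i hi).1) (fun y hy i hi => (hsub y hy i hi).2) hcard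
      have hN : ∀ y, (within G (insert v T : Finset V)).Adj v y → y ∈ N := by
        rintro y ⟨h1, -, h2⟩
        exact Finset.mem_filter.2 ⟨(Finset.mem_insert.1 h2).resolve_left h1.ne', h1⟩
      have hT : ∀ x y, (within G (insert v T : Finset V)).Adj x y → x ≠ v → y ≠ v →
          (within G T).Adj x y := fun x y h hx hy =>
        ⟨h.1, (Finset.mem_insert.1 h.2.1).resolve_left hx,
          (Finset.mem_insert.1 h.2.2).resolve_left hy⟩
      refine ⟨recolorAt c' v f, fun x y z hxy hxz hyz => ?_, fun x y hxy => ?_⟩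
      · by_cases hx : x = v
        · subst hx
          rw [recolorAt_left, recolorAt_left]
          exact fun h => hyz (hf (hN y hxy) (hN z hxz) h)
        · by_cases hy : y = v
          · subst hy
            rw [recolorAt_right, recolorAt_of_ne c' f hx hyz.symm]
            exact ((hfC x (hN x hxy.symm)).2 z (hT x z hxz hx hyz.symm)).symm
          · by_cases hz : z = v
            · subst hz
              rw [recolorAt_right, recolorAt_of_ne c' f hx hyz]
              exact (hfC x (hN x hxz.symm)).2 y (hT x y hxy hx hyz)
            · rw [recolorAt_of_ne c' f hx hy, recolorAt_of_ne c' f hx hz]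
              exact hc' (hT x y hxy hx hy) (hT x z hxz hx hz) hyz
      · by_cases hx : x = v
        · subst hx
          rw [recolorAt_left]
          exact (hfC y (hN y hxy)).1
        · by_cases hy : y = v
          · subst hy
            rw [recolorAt_right]
            exact (hfC x (hN x hxy.symm)).1
          · rw [recolorAt_of_ne c' f hx hy]
            rcases hcc' s(x, y) with h | h
            · rw [h]
              exact hcD x y (hT x y hxy hx hy)
            · exact h.2
  obtain ⟨c, hc, hcD⟩ := key Finset.univ
  have huniv : ∀ u v, G.Adj u v → (within G (Finset.univ : Finset V)).Adj u v :=
    fun u v h => ⟨h, Finset.mem_coe.2 (Finset.mem_univ u), Finset.mem_coe.2 (Finset.mem_univ v)⟩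
  exact ⟨c, fun u v w huv huw => hc (huniv u v huv) (huniv u w huw),
    fun u v h => Nat.lt_succ_iff.1 (Finset.mem_range.1 (hcD u v (huniv u v h)))⟩

/-- A kernel of a finite digraph whose arcs go between two sides: an independent set which
every other vertex sends an arc to. -/
theorem exists_kernel {X : Type*} (side : X → Bool) (A : X → X → Prop)
    (hA : ∀ x y, A x y → side x ≠ side y) (n : ℕ) : ∀ S : Finset X, S.card = n →
    ∃ K ⊆ S, (∀ x ∈ K, ∀ y ∈ K, ¬ A x y) ∧ ∀ x ∈ S, x ∉ K → ∃ y ∈ K, A x y := by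
  induction n using Nat.strong_induction_on with
  | _ n ih =>
  intro S hn
  by_cases hsink : ∃ s ∈ S, ∀ y ∈ S, ¬ A s y
  · obtain ⟨s, hs, hsA⟩ := hsink
    have hlt : (S.filter fun x => x ≠ s ∧ ¬ A x s).card < n := by
      rw [← hn]
      exact Finset.card_lt_card ((Finset.ssubset_iff_of_subset (Finset.filter_subset _ _)).2
        ⟨s, hs, by simp⟩)
    obtain ⟨K, hKS, hK, hdom⟩ := ih _ hlt _ rfl
    have hKS' : ∀ x ∈ K, x ∈ S ∧ x ≠ s ∧ ¬ A x s := fun x hx => Finset.mem_filter.1 (hKS hx)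
    refine ⟨insert s K, fun x hx => ?_, fun x hx y hy => ?_, fun x hx hxK => ?_⟩
    · rcases Finset.mem_insert.1 hx with rfl | hx
      exacts [hs, (hKS' x hx).1]
    · rcases Finset.mem_insert.1 hx with rfl | hxK <;>
        rcases Finset.mem_insert.1 hy with rfl | hyK
      · exact hsA _ hs
      · exact hsA y (hKS' y hyK).1
      · exact (hKS' x hxK).2.2
      · exact hK x hxK y hyK
    · rw [Finset.mem_insert, not_or] at hxK
      by_cases hxs : A x s
      · exact ⟨s, Finset.mem_insert_self s K, hxs⟩
      · obtain ⟨y, hy, hxy⟩ := hdom x (Finset.mem_filter.2 ⟨hx, hxK.1, hxs⟩) hxK.2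
        exact ⟨y, Finset.mem_insert_of_mem hy, hxy⟩
  · push Not at hsink
    refine ⟨S.filter fun x => side x = true, Finset.filter_subset _ _, fun x hx y hy h => ?_,
      fun x hx hxK => ?_⟩
    · rw [Finset.mem_filter] at hx hy
      exact hA x y h (hx.2.trans hy.2.symm)
    · obtain ⟨y, hy, hxy⟩ := hsink x hx
      have h1 : side x ≠ true := fun h => hxK (Finset.mem_filter.2 ⟨hx, h⟩)
      have h2 := hA x y hxy
      refine ⟨y, Finset.mem_filter.2 ⟨hy, ?_⟩, hxy⟩
      revert h1 h2
      cases side x <;> cases side y <;> simp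

/-- List colouring of bipartite conflict graphs with an orientation of small out-degrees. -/
theorem exists_list_coloring {X : Type*} (side : X → Bool) (A : X → X → Prop)
    (hA : ∀ x y, A x y → side x ≠ side y) (n : ℕ) : ∀ (S : Finset X) (L : X → Finset ℕ),
    S.card = n → (∀ x ∈ S, (S.filter (A x)).card < (L x).card) →
    ∃ f : X → ℕ, (∀ x ∈ S, f x ∈ L x) ∧ ∀ x ∈ S, ∀ y ∈ S, A x y → f x ≠ f y := by
  induction n using Nat.strong_induction_on with
  | _ n ih =>
  intro S L hn hL
  obtain rfl | ⟨x₀, hx₀⟩ := S.eq_empty_or_nonempty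
  · exact ⟨fun _ => 0, by simp, by simp⟩
  obtain ⟨c, hc⟩ := Finset.card_pos.1 (pos_of_gt (hL x₀ hx₀))
  obtain ⟨K, hKS, hK, hdom⟩ := exists_kernel side A hA _ (S.filter fun x => c ∈ L x) rfl
  have hKS' : ∀ x ∈ K, x ∈ S ∧ c ∈ L x := fun x hx => Finset.mem_filter.1 (hKS hx)
  have hKne : K.Nonempty := by
    by_cases h : x₀ ∈ K
    · exact ⟨x₀, h⟩
    · obtain ⟨y, hy, -⟩ := hdom x₀ (Finset.mem_filter.2 ⟨hx₀, hc⟩) h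
      exact ⟨y, hy⟩
  have hlt : (S \ K).card < n := by
    rw [← hn]
    obtain ⟨y, hy⟩ := hKne
    exact Finset.card_lt_card ((Finset.ssubset_iff_of_subset Finset.sdiff_subset).2
      ⟨y, (hKS' y hy).1, by simp [hy]⟩)
  obtain ⟨f, hfL, hf⟩ := ih _ hlt (S \ K) (fun x => (L x).erase c) rfl fun x hx => by
    rw [Finset.mem_sdiff] at hx
    by_cases hcx : c ∈ L x
    · obtain ⟨y, hy, hxy⟩ := hdom x (Finset.mem_filter.2 ⟨hx.1, hcx⟩) hx.2
      have h1 := hL x hx.1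
      have h2 : ((S \ K).filter (A x)).card < (S.filter (A x)).card := by
        refine Finset.card_lt_card ((Finset.ssubset_iff_of_subset
          (Finset.filter_subset_filter _ Finset.sdiff_subset)).2 ⟨y, ?_, ?_⟩)
        · exact Finset.mem_filter.2 ⟨(hKS' y hy).1, hxy⟩
        · simp [hy]
      have h3 := Finset.card_erase_add_one hcx
      omega
    · rw [Finset.erase_eq_of_notMem hcx]
      exact (Finset.card_le_card (Finset.filter_subset_filter _ Finset.sdiff_subset)).trans_lt
        (hL x hx.1)
  refine ⟨fun x => if x ∈ K then c else f x, fun x hx => ?_, fun x hx y hy hxy => ?_⟩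
  · by_cases h : x ∈ K
    · simpa [h] using (hKS' x h).2
    · simpa [h] using Finset.mem_of_mem_erase (hfL x (Finset.mem_sdiff.2 ⟨hx, h⟩))
  · have hne : ∀ z ∈ S, z ∉ K → f z ≠ c := fun z hz hzK =>
      Finset.ne_of_mem_erase (hfL z (Finset.mem_sdiff.2 ⟨hz, hzK⟩))
    by_cases h : x ∈ K <;> by_cases h' : y ∈ K
    · exact absurd hxy (hK x h y h')
    · simpa [h, h'] using (hne y hy h').symm
    · simpa [h, h'] using hne x hx h
    · simpa [h, h'] using hf x (Finset.mem_sdiff.2 ⟨hx, h⟩) y (Finset.mem_sdiff.2 ⟨hy, h'⟩) hxy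

/-- `ψ` is a list colouring of the edges in `R`. -/
def EdgeListColoring (R : Finset (Sym2 V)) (L : Sym2 V → Finset ℕ) (ψ : Sym2 V → ℕ) : Prop :=
  ∀ e ∈ R, ψ e ∈ L e ∧ ∀ f ∈ R, e ≠ f → (∃ u ∈ e, u ∈ f) → ψ e ≠ ψ f

theorem EdgeListColoring.extend {L : Sym2 V → Finset ℕ} {R₁ R₂ R : Finset (Sym2 V)}
    {ψ : Sym2 V → ℕ} (hψ : EdgeListColoring R₁ L ψ) (side : Sym2 V → Bool)
    (A : Sym2 V → Sym2 V → Prop) (hA : ∀ e f, A e f → side e ≠ side f)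
    (hconf : ∀ e ∈ R₂, ∀ f ∈ R₂, e ≠ f → (∃ u ∈ e, u ∈ f) → A e f ∨ A f e)
    (hR : ∀ e ∈ R, e ∈ R₁ ∨ e ∈ R₂)
    (hL : ∀ e ∈ R₂, (R₁.filter fun f => e ≠ f ∧ ∃ u ∈ e, u ∈ f).card + (R₂.filter (A e)).card <
      (L e).card) :
    ∃ ψ', EdgeListColoring R L ψ' := by
  let L' : Sym2 V → Finset ℕ := fun e =>
    L e \ (R₁.filter fun f => e ≠ f ∧ ∃ u ∈ e, u ∈ f).image ψ
  obtain ⟨g, hgL, hg⟩ := exists_list_coloring side A hA _ R₂ L' rfl fun e he => by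
    have h1 := hL e he
    have h2 := Finset.le_card_sdiff ((R₁.filter fun f => e ≠ f ∧ ∃ u ∈ e, u ∈ f).image ψ) (L e)
    have h3 := Finset.card_image_le (s := R₁.filter fun f => e ≠ f ∧ ∃ u ∈ e, u ∈ f) (f := ψ)
    simp only [L']
    omega
  have hmix : ∀ e ∈ R₁, ∀ f ∈ R₂, e ≠ f → (∃ u ∈ e, u ∈ f) → ψ e ≠ g f := by
    intro e he f hf hne ⟨u, hue, huf⟩ heq
    have := (Finset.mem_sdiff.1 (hgL f hf)).2
    rw [← heq] at this
    exact this (Finset.mem_image_of_mem ψ (Finset.mem_filter.2 ⟨he, hne.symm, u, huf, hue⟩))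
  refine ⟨fun e => if e ∈ R₁ then ψ e else g e, fun e he => ?_⟩
  by_cases h1 : e ∈ R₁
  · refine ⟨by simpa [h1] using (hψ e h1).1, fun f hf hef hu => ?_⟩
    by_cases h2 : f ∈ R₁
    · simpa [h1, h2] using (hψ e h1).2 f h2 hef hu
    · simpa [h1, h2] using hmix e h1 f ((hR f hf).resolve_left h2) hef hu
  · have h1' := (hR e he).resolve_left h1
    refine ⟨by simpa [h1] using (Finset.mem_sdiff.1 (hgL e h1')).1, fun f hf hef hu => ?_⟩
    by_cases h2 : f ∈ R₁
    · obtain ⟨u, hue, huf⟩ := hu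
      simpa [h1, h2] using (hmix f h2 e h1' hef.symm ⟨u, huf, hue⟩).symm
    · have h2' := (hR f hf).resolve_left h2
      simp only [h1, h2, if_false]
      rcases hconf e h1' f h2' hef hu with h | h
      · exact hg e h1' f h2' h
      · exact (hg f h2' e h1' h).symm

/-- A union of two matchings is edge-colourable from lists of size two. -/
theorem exists_edgeListColoring_of_two {c : Sym2 V → ℕ} {R : Finset (Sym2 V)}
    (hc : ∀ e ∈ R, ∀ f ∈ R, ∀ u, u ∈ e → u ∈ f → c e = c f → e = f) (hR : ∀ e ∈ R, c e ≤ 1)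
    {L : Sym2 V → Finset ℕ} (hL : ∀ e ∈ R, 2 ≤ (L e).card) :
    ∃ ψ, EdgeListColoring R L ψ := by
  let W : Set V := {v | 2 ≤ (R.filter fun e => v ∈ e).card}
  have hall : ∀ s : Finset W, s.card ≤
      (s.biUnion fun v => R.filter fun e => (v : V) ∈ e).card := by
    intro s
    have h1 := Finset.sum_card_bipartiteAbove_eq_sum_card_bipartiteBelow (s := s)
      (t := s.biUnion fun v => R.filter fun e => (v : V) ∈ e) fun (v : W) e => (v : V) ∈ e
    have h2 : s.card • 2 ≤ ∑ v ∈ s, (Finset.bipartiteAbove (fun (v : W) e => (v : V) ∈ e)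
        (s.biUnion fun v => R.filter fun e => (v : V) ∈ e) v).card := by
      refine Finset.card_nsmul_le_sum _ _ _ fun v hv => v.2.trans (Finset.card_le_card ?_)
      intro e he
      rw [Finset.bipartiteAbove, Finset.mem_filter]
      exact ⟨Finset.mem_biUnion.2 ⟨v, hv, he⟩, (Finset.mem_filter.1 he).2⟩
    have h3 : ∑ e ∈ s.biUnion (fun v => R.filter fun e => (v : V) ∈ e),
        (Finset.bipartiteBelow (fun (v : W) e => (v : V) ∈ e) s e).card ≤
        (s.biUnion fun v => R.filter fun e => (v : V) ∈ e).card • 2 := by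
      refine Finset.sum_le_card_nsmul _ _ _ fun e _ => ?_
      induction e using Sym2.ind with
      | _ p q =>
      have : ((Finset.bipartiteBelow (fun (v : W) e => (v : V) ∈ e) s s(p, q)).image
          Subtype.val).card ≤ ({p, q} : Finset V).card := by
        refine Finset.card_le_card fun v hv => ?_
        simp only [Finset.bipartiteBelow, Finset.mem_image, Finset.mem_filter] at hv
        obtain ⟨v', hv', rfl⟩ := hv
        simpa using hv'.2
      rw [Finset.card_image_of_injective _ Subtype.val_injective] at this
      exact this.trans Finset.card_le_two
    rw [smul_eq_mul] at h2 h3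
    omega
  obtain ⟨h, hinj, hh⟩ := (Finset.all_card_le_biUnion_card_iff_exists_injective
    fun v : W => R.filter fun e => (v : V) ∈ e).1 hall
  obtain ⟨A, hA⟩ : ∃ A : Sym2 V → Sym2 V → Prop, ∀ e f, A e f ↔ e ∈ R ∧ f ∈ R ∧ e ≠ f ∧
    ∃ v : W, h v = e ∧ (v : V) ∈ f := ⟨_, fun _ _ => Iff.rfl⟩
  have hhm : ∀ v : W, (v : V) ∈ h v := fun v => (Finset.mem_filter.1 (hh v)).2
  have huniq : ∀ e ∈ R, ∀ f ∈ R, ∀ f' ∈ R, e ≠ f → e ≠ f' → ∀ v, v ∈ e → v ∈ f → v ∈ f' →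
      f = f' := by
    intro e he f hf f' hf' hef hef' v h1 h2 h3
    have e1 := mt (hc e he f hf v h1 h2) hef
    have e2 := mt (hc e he f' hf' v h1 h3) hef'
    have := hR e he
    have := hR f hf
    have := hR f' hf'
    exact hc f hf f' hf' v h2 h3 (by omega)
  refine EdgeListColoring.extend (R₁ := ∅) (R₂ := R) (ψ := fun _ => 0)
    (fun e he => absurd he (Finset.notMem_empty e)) (fun e => decide (c e = 0)) A ?_ ?_
    (fun e he => Or.inr he) fun e he => ?_
  · intro e f hAef
    obtain ⟨he, hf, hef, v, rfl, hv⟩ := (hA e f).1 hAef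
    have e1 := mt (hc _ he f hf v (hhm v) hv) hef
    have := hR _ he
    have := hR f hf
    intro h
    rw [decide_eq_decide] at h
    omega
  · rintro e he f hf hef ⟨u, hue, huf⟩
    have hu : u ∈ W := by
      have : ({e, f} : Finset (Sym2 V)).card ≤ (R.filter fun e => u ∈ e).card := by
        refine Finset.card_le_card fun x hx => ?_
        simp only [Finset.mem_insert, Finset.mem_singleton] at hx
        rcases hx with rfl | rfl
        · exact Finset.mem_filter.2 ⟨he, hue⟩
        · exact Finset.mem_filter.2 ⟨hf, huf⟩
      rwa [Finset.card_pair hef] at this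
    by_cases h1 : h ⟨u, hu⟩ = e
    · exact Or.inl ((hA e f).2 ⟨he, hf, hef, ⟨u, hu⟩, h1, huf⟩)
    · refine Or.inr ((hA f e).2 ⟨hf, he, hef.symm, ⟨u, hu⟩, ?_, hue⟩)
      exact (huniq e he f hf _ (Finset.mem_filter.1 (hh ⟨u, hu⟩)).1 hef (Ne.symm h1) u hue huf
        (hhm ⟨u, hu⟩)).symm
  · simp only [Finset.filter_empty, Finset.card_empty, zero_add]
    refine lt_of_le_of_lt (b := 1) ?_ (hL e he)
    rw [Finset.card_le_one]
    intro f hf f' hf'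
    obtain ⟨-, hf, hef, v, hve, hvf⟩ := (hA e f).1 (Finset.mem_filter.1 hf).2
    obtain ⟨-, hf', hef', v', hve', hvg⟩ := (hA e f').1 (Finset.mem_filter.1 hf').2
    have hvv : v = v' := hinj (hve.trans hve'.symm)
    subst hvv
    exact huniq e he f hf f' hf' hef hef' v (hve ▸ hhm v) hvf hvg

/-- Three matchings `c = 0, 1, 2` in a graph with edges `E`, where the edges of colour `2` that
matter are the edges `z (w z)` at the vertices of an independent set `Z`, each of which is on at
most one edge of colour `0` or `1`. -/
structure BadVertices (E : Finset (Sym2 V)) (c : Sym2 V → ℕ) (Z : Finset V) (w : V → V) :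
    Prop where
  proper : ∀ e ∈ E, ∀ f ∈ E, ∀ u, u ∈ e → u ∈ f → c e = c f → e = f
  mem : ∀ z ∈ Z, s(z, w z) ∈ E
  color : ∀ z ∈ Z, c s(z, w z) = 2
  ne : ∀ z ∈ Z, ∀ y ∈ Z, w z ≠ y
  indep : ∀ z ∈ Z, ∀ e ∈ E, z ∈ e → ∀ y ∈ Z, y ∈ e → y = z
  unique : ∀ z ∈ Z, ∀ e ∈ E, ∀ f ∈ E, z ∈ e → z ∈ f → c e ≤ 1 → c f ≤ 1 → e = f

namespace BadVertices

variable {E : Finset (Sym2 V)} {c : Sym2 V → ℕ} {Z : Finset V} {w : V → V}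

theorem injOn (h : BadVertices E c Z w) {z z' : V} (hz : z ∈ Z) (hz' : z' ∈ Z)
    (hw : w z = w z') : z = z' := by
  have h1 := h.proper _ (h.mem z hz) _ (h.mem z' hz') (w z) (Sym2.mem_mk_right _ _)
    (hw ▸ Sym2.mem_mk_right _ _) ((h.color z hz).trans (h.color z' hz').symm)
  exact h.indep z' hz' _ (h.mem z' hz') (Sym2.mem_mk_left _ _) z hz (h1 ▸ Sym2.mem_mk_left _ _)

/-- The edge of colour `0` or `1` at `y` leads to `w z`. -/
def Child (E : Finset (Sym2 V)) (c : Sym2 V → ℕ) (w : V → V) (y z : V) : Prop :=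
  ∃ e ∈ E, c e ≤ 1 ∧ y ∈ e ∧ w z ∈ e

theorem eq_of_child (h : BadVertices E c Z w) {y z z' : V} (hy : y ∈ Z) (hz : z ∈ Z) (hz' : z' ∈ Z)
    (h1 : Child E c w y z) (h2 : Child E c w y z') : z = z' := by
  obtain ⟨e, he, hce, hye, hwe⟩ := h1
  obtain ⟨e', he', hce', hye', hwe'⟩ := h2
  obtain rfl := h.unique y hy e he e' he' hye hye' hce hce'
  obtain rfl := (Sym2.mem_and_mem_iff (h.ne z hz y hy).symm).1 ⟨hye, hwe⟩
  rcases Sym2.mem_iff.1 hwe' with hw | hw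
  · exact absurd hw (h.ne z' hz' y hy)
  · exact h.injOn hz hz' hw.symm

/-- The edges to be coloured once the vertices in `D` have been dealt with. -/
noncomputable def edges (E : Finset (Sym2 V)) (c : Sym2 V → ℕ) (Z : Finset V) (w : V → V)
    (D : Finset V) : Finset (Sym2 V) :=
  E.filter fun e => (c e ≤ 1 ∧ ∀ z ∈ Z, z ∈ e → z ∈ D) ∨ ∃ z ∈ D, e = s(z, w z)

theorem mem_edges {D : Finset V} {e : Sym2 V} : e ∈ edges E c Z w D ↔
    e ∈ E ∧ ((c e ≤ 1 ∧ ∀ z ∈ Z, z ∈ e → z ∈ D) ∨ ∃ z ∈ D, e = s(z, w z)) :=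
  Finset.mem_filter

theorem extend (h : BadVertices E c Z w) {L : Sym2 V → Finset ℕ}
    (hL : ∀ z ∈ Z, ∀ e ∈ E, z ∈ e → 3 ≤ (L e).card) {D U : Finset V} (hD : D ⊆ Z) (hU : U ⊆ Z)
    (hDU : ∀ z ∈ U, z ∉ D) (hclosed : ∀ z ∈ D, ∀ y ∈ Z, Child E c w y z → y ∈ D)
    (hEnd : ∀ e ∈ E, ∀ f ∈ E, c e ≤ 1 → c f ≤ 1 → (∃ z ∈ U, z ∈ e) → (∃ z ∈ U, z ∈ f) →
      (∃ u ∈ e, u ∈ f) → e = f)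
    {ψ : Sym2 V → ℕ} (hψ : EdgeListColoring (edges E c Z w D) L ψ) :
    ∃ ψ', EdgeListColoring (edges E c Z w (D ∪ U)) L ψ' := by
  have hR₁ := fun e => mem_edges (E := E) (c := c) (Z := Z) (w := w) (D := D) (e := e)
  obtain ⟨R₂, hR₂⟩ : ∃ R₂ : Finset (Sym2 V), ∀ e, e ∈ R₂ ↔
      e ∈ E ∧ ((c e ≤ 1 ∧ ∃ z ∈ U, z ∈ e) ∨ ∃ z ∈ U, e = s(z, w z)) :=
    ⟨E.filter _, fun e => Finset.mem_filter⟩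
  obtain ⟨A, hA⟩ : ∃ A : Sym2 V → Sym2 V → Prop, ∀ e f, A e f ↔
      (c e ≤ 1 ∧ c f = 2 ∧ ∃ z ∈ U, z ∈ e ∧ f = s(z, w z)) ∨
      (c e = 2 ∧ c f ≤ 1 ∧ ∃ z ∈ U, e = s(z, w z) ∧ w z ∈ f) := ⟨_, fun _ _ => Iff.rfl⟩
  have hcol : ∀ z ∈ U, c s(z, w z) = 2 := fun z hz => h.color z (hU hz)
  refine hψ.extend (R₂ := R₂) (fun e => decide (c e ≤ 1)) A (fun e f hef => ?_)
    (fun e he f hf hef hu => ?_) (fun e he => ?_) fun e he => ?_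
  · rw [hA] at hef
    intro hc
    rw [decide_eq_decide] at hc
    omega
  · rw [hR₂] at he hf
    rw [hA, hA]
    rcases he with ⟨he, ⟨hce, z, hz, hze⟩ | ⟨z, hz, rfl⟩⟩ <;>
      rcases hf with ⟨hf, ⟨hcf, y, hy, hyf⟩ | ⟨y, hy, rfl⟩⟩
    · exact absurd (hEnd e he f hf hce hcf ⟨z, hz, hze⟩ ⟨y, hy, hyf⟩ hu) hef
    · obtain ⟨u, hue, huf⟩ := hu
      rcases Sym2.mem_iff.1 huf with rfl | rfl
      · exact Or.inl (Or.inl ⟨hce, hcol _ hy, u, hy, hue, rfl⟩)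
      · exact Or.inr (Or.inr ⟨hcol _ hy, hce, y, hy, rfl, hue⟩)
    · obtain ⟨u, hue, huf⟩ := hu
      rcases Sym2.mem_iff.1 hue with rfl | rfl
      · exact Or.inr (Or.inl ⟨hcf, hcol _ hz, u, hz, huf, rfl⟩)
      · exact Or.inl (Or.inr ⟨hcol _ hz, hcf, z, hz, rfl, huf⟩)
    · obtain ⟨u, hue, huf⟩ := hu
      exact absurd (h.proper _ he _ hf u hue huf ((hcol z hz).trans (hcol y hy).symm)) hef
  · rw [hR₁, hR₂]
    obtain ⟨heE, he⟩ := mem_edges.1 he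
    rcases he with ⟨hce, he⟩ | ⟨z, hz, rfl⟩
    · by_cases hex : ∃ z ∈ U, z ∈ e
      · exact Or.inr ⟨heE, Or.inl ⟨hce, hex⟩⟩
      · refine Or.inl ⟨heE, Or.inl ⟨hce, fun z hz hze => ?_⟩⟩
        exact (Finset.mem_union.1 (he z hz hze)).resolve_right fun hzU => hex ⟨z, hzU, hze⟩
    · rcases Finset.mem_union.1 hz with hz | hz
      · exact Or.inl ⟨heE, Or.inr ⟨z, hz, rfl⟩⟩
      · exact Or.inr ⟨heE, Or.inr ⟨z, hz, rfl⟩⟩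
  · obtain ⟨heE, he⟩ := (hR₂ e).1 he
    rcases he with ⟨hce, z, hz, hze⟩ | ⟨z, hz, rfl⟩
    · have hL3 := hL z (hU hz) e heE hze
      obtain ⟨x, rfl⟩ := hze
      have key : ∀ f ∈ edges E c Z w D, s(z, x) ≠ f → (∃ u ∈ s(z, x), u ∈ f) →
          f ∈ E ∧ x ∈ f ∧ c f ≤ 1 ∧ c f ≠ c s(z, x) := by
        rintro f hf hne ⟨u, hu, huf⟩
        obtain ⟨hfE, hf⟩ := (hR₁ f).1 hf
        rcases hf with ⟨hcf, hf⟩ | ⟨y, hy, rfl⟩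
        · refine ⟨hfE, ?_, hcf, fun hc => hne (h.proper _ heE f hfE u hu huf hc.symm)⟩
          rcases Sym2.mem_iff.1 hu with rfl | rfl
          · exact absurd (hf u (hU hz) huf) (hDU u hz)
          · exact huf
        · exfalso
          rcases Sym2.mem_iff.1 huf with rfl | rfl
          · exact hDU z hz (h.indep z (hU hz) _ heE (Sym2.mem_mk_left _ _) u (hD hy) hu ▸ hy)
          · exact hDU z hz (hclosed y hy z (hU hz) ⟨_, heE, hce, Sym2.mem_mk_left _ _, hu⟩)
      have h1 : ((edges E c Z w D).filter fun f => s(z, x) ≠ f ∧ ∃ u ∈ s(z, x), u ∈ f).card ≤ 1 := by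
        rw [Finset.card_le_one]
        intro f hf f' hf'
        rw [Finset.mem_filter] at hf hf'
        obtain ⟨a1, a2, a3, a4⟩ := key f hf.1 hf.2.1 hf.2.2
        obtain ⟨b1, b2, b3, b4⟩ := key f' hf'.1 hf'.2.1 hf'.2.2
        exact h.proper f a1 f' b1 x a2 b2 (by omega)
      have h2 : (R₂.filter (A s(z, x))).card ≤ 1 := by
        rw [Finset.card_le_one]
        have : ∀ f ∈ R₂.filter (A s(z, x)), f = s(z, w z) := by
          intro f hf
          rw [Finset.mem_filter, hA] at hf
          rcases hf.2 with ⟨-, -, y, hy, hye, rfl⟩ | ⟨hc, -⟩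
          · rw [h.indep z (hU hz) _ heE (Sym2.mem_mk_left _ _) y (hU hy) hye]
          · omega
        exact fun f hf f' hf' => (this f hf).trans (this f' hf').symm
      omega
    · have hL3 := hL z (hU hz) _ heE (Sym2.mem_mk_left _ _)
      refine lt_of_le_of_lt (b := 2) ?_ hL3
      rw [← Finset.card_union_of_disjoint]
      · have hT : (E.filter fun f => c f ≤ 1 ∧ w z ∈ f).card ≤ (Finset.range 2).card := by
          refine Finset.card_le_card_of_injOn c (fun f hf => ?_) fun f hf f' hf' hff => ?_
          · have := (Finset.mem_filter.1 (Finset.mem_coe.1 hf)).2.1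
            simp only [Finset.coe_range, Set.mem_Iio]
            omega
          · have a := Finset.mem_filter.1 (Finset.mem_coe.1 hf)
            have b := Finset.mem_filter.1 (Finset.mem_coe.1 hf')
            exact h.proper f a.1 f' b.1 (w z) a.2.2 b.2.2 hff
        rw [Finset.card_range] at hT
        refine (Finset.card_le_card fun f hf => ?_).trans hT
        rw [Finset.mem_union, Finset.mem_filter, Finset.mem_filter] at hf
        rw [Finset.mem_filter]
        rcases hf with ⟨hf, hne, u, hu, huf⟩ | ⟨hf, hAf⟩
        · obtain ⟨hfE, hf⟩ := (hR₁ f).1 hf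
          rcases hf with ⟨hcf, hf⟩ | ⟨y, hy, rfl⟩
          · refine ⟨hfE, hcf, ?_⟩
            rcases Sym2.mem_iff.1 hu with rfl | rfl
            · exact absurd (hf u (hU hz) huf) (hDU u hz)
            · exact huf
          · exact absurd (h.proper _ heE _ hfE u hu huf
              ((hcol z hz).trans (h.color y (hD hy)).symm)) hne
        · rw [hA] at hAf
          rcases hAf with ⟨hc, -⟩ | ⟨-, hcf, y, hy, hyz, hyf⟩
          · rw [hcol z hz] at hc
            omega
          · have : z = y := h.indep y (hU hy) _ (h.mem y (hU hy)) (Sym2.mem_mk_left _ _) z (hU hz)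
              (hyz ▸ Sym2.mem_mk_left _ _)
            exact ⟨((hR₂ f).1 hf).1, hcf, this ▸ hyf⟩
      · rw [Finset.disjoint_left]
        intro f hf hf'
        rw [Finset.mem_filter] at hf hf'
        rw [hA, hcol z hz] at hf'
        have hcf : c f ≤ 1 := by
          rcases hf'.2 with ⟨hc, -⟩ | ⟨-, hc, -⟩
          · omega
          · exact hc
        rcases ((hR₁ f).1 hf.1).2 with ⟨-, h1⟩ | ⟨y, hy, rfl⟩
        · rcases ((hR₂ f).1 hf'.1).2 with ⟨-, y, hy, hyf⟩ | ⟨y, hy, rfl⟩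
          · exact hDU y hy (h1 y (hU hy) hyf)
          · rw [hcol y hy] at hcf
            omega
        · rw [h.color y (hD hy)] at hcf
          omega

theorem exists_edgeListColoring (h : BadVertices E c Z w) {L : Sym2 V → Finset ℕ}
    (hL2 : ∀ e ∈ E, 2 ≤ (L e).card) (hL : ∀ z ∈ Z, ∀ e ∈ E, z ∈ e → 3 ≤ (L e).card) :
    ∃ ψ, EdgeListColoring (edges E c Z w Z) L ψ := by
  obtain ⟨P, hP⟩ : ∃ P : Finset (Finset V), ∀ D, D ∈ P ↔ D ∈ Z.powerset ∧
      (∀ z ∈ D, ∀ y ∈ Z, Child E c w y z → y ∈ D) ∧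
        ∃ ψ, EdgeListColoring (edges E c Z w D) L ψ :=
    ⟨Z.powerset.filter _, fun D => Finset.mem_filter⟩
  obtain ⟨D, hDm, hmax⟩ := Finset.exists_max_image P Finset.card ⟨∅, by
      rw [hP]
      refine ⟨Finset.empty_mem_powerset Z, by simp, ?_⟩
      have hsub : ∀ e ∈ edges E c Z w ∅, e ∈ E ∧ c e ≤ 1 := fun e he => by
        obtain ⟨heE, he⟩ := mem_edges.1 he
        rcases he with he | ⟨z, hz, -⟩
        · exact ⟨heE, he.1⟩
        · exact absurd hz (Finset.notMem_empty z)
      exact exists_edgeListColoring_of_two (fun e he f hf => h.proper e (hsub e he).1 f (hsub f hf).1)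
        (fun e he => (hsub e he).2) fun e he => hL2 e (hsub e he).1⟩
  rw [hP, Finset.mem_powerset] at hDm
  obtain ⟨hD, hclosed, ψ, hψ⟩ := hDm
  have hchild : ∀ z, ∃ y, z ∈ Z \ D → y ∈ Z \ D ∧ Child E c w y z := by
    intro z
    by_contra! hcon
    have hz := (hcon z).1
    have hzc := fun y => (hcon y).2
    rw [Finset.mem_sdiff] at hz
    have hU : {z} ⊆ Z := by simpa using hz.1
    obtain ⟨ψ', hψ'⟩ := h.extend hL hD hU (by simpa using hz.2) hclosed (by
      simp only [Finset.mem_singleton, exists_eq_left]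
      exact fun e he f hf hce hcf hze hzf _ => h.unique z hz.1 e he f hf hze hzf hce hcf) hψ
    have := hmax (D ∪ {z}) (by
      rw [hP, Finset.mem_powerset]
      refine ⟨Finset.union_subset hD hU, fun x hx y hy hyx => ?_, ψ', hψ'⟩
      rw [Finset.mem_union, Finset.mem_singleton] at hx ⊢
      left
      rcases hx with hx | rfl
      · exact hclosed x hx y hy hyx
      · by_contra hyD
        exact hzc y (Finset.mem_sdiff.2 ⟨hy, hyD⟩) hyx)
    rw [Finset.card_union_of_disjoint (by simpa using hz.2), Finset.card_singleton] at this
    omega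
  choose g hg using hchild
  have hUZ : Z \ D ⊆ Z := Finset.sdiff_subset
  have hsurj : ∀ y ∈ Z \ D, ∃ z ∈ Z \ D, g z = y := by
    have := Finset.surjOn_of_injOn_of_card_le (s := Z \ D) (t := Z \ D) g
      (fun z hz => Finset.mem_coe.2 (hg z hz).1) (fun z hz z' hz' heq => h.eq_of_child
        (hUZ (hg z hz).1) (hUZ hz) (hUZ hz') (hg z hz).2 (heq ▸ (hg z' hz').2)) le_rfl
    intro y hy
    obtain ⟨z, hz, rfl⟩ := this hy
    exact ⟨z, hz, rfl⟩
  have := h.extend hL hD hUZ (fun z hz => (Finset.mem_sdiff.1 hz).2) hclosed ?_ hψ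
  · rwa [Finset.union_sdiff_of_subset hD] at this
  rintro e he f hf hce hcf ⟨y, hy, hye⟩ ⟨y', hy', hyf⟩ ⟨u, hue, huf⟩
  suffices y = y' by
    subst this
    exact h.unique y (hUZ hy) e he f hf hye hyf hce hcf
  obtain ⟨z, hz, rfl⟩ := hsurj y hy
  obtain ⟨z', hz', rfl⟩ := hsurj y' hy'
  have hform : ∀ y ∈ Z \ D, ∀ z ∈ Z \ D, ∀ e ∈ E, c e ≤ 1 → y ∈ e → Child E c w y z →
      e = s(y, w z) := by
    rintro y hy z hz e he hce hye ⟨e', he', hce', hye', hwe⟩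
    obtain rfl := h.unique y (hUZ hy) e he e' he' hye hye' hce hce'
    exact (Sym2.mem_and_mem_iff (h.ne z (hUZ hz) y (hUZ hy)).symm).1 ⟨hye, hwe⟩
  have e1 := hform _ hy z hz e he hce hye (hg z hz).2
  have e2 := hform _ hy' z' hz' f hf hcf hyf (hg z' hz').2
  rcases Sym2.mem_iff.1 (e1 ▸ hue) with rfl | rfl
  · exact h.indep _ (hUZ hy') f hf hyf _ (hUZ hy) huf
  · rcases Sym2.mem_iff.1 (e2 ▸ huf) with hu | hu
    · exact absurd hu (h.ne z (hUZ hz) _ (hUZ hy'))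
    · rw [h.injOn (hUZ hz) (hUZ hz') hu]

end BadVertices

/-- `G` has a total coloring with colours `0, …, k - 1`. -/
def TotalColorable (G : SimpleGraph V) (k : ℕ) : Prop :=
  ∃ cv ce, IsTotalColoring G cv ce ∧ (∀ v, cv v < k) ∧ ∀ e ∈ G.edgeSet, ce e < k

theorem IsProperEdgeColoring.eq_of_mem {G : SimpleGraph V} {c : Sym2 V → ℕ}
    (hc : IsProperEdgeColoring G c) {e f : Sym2 V} (he : e ∈ G.edgeSet) (hf : f ∈ G.edgeSet)
    {u : V} (hue : u ∈ e) (huf : u ∈ f) (hef : c e = c f) : e = f := by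
  obtain ⟨a, rfl⟩ := hue
  obtain ⟨b, rfl⟩ := huf
  by_contra hne
  exact hc he hf (fun hab => hne (congrArg (fun x => s(u, x)) hab)) hef

theorem totalColorable_of_five_coloring [Fintype V] (G : SimpleGraph V) {D : ℕ} (hD2 : 2 ≤ D)
    (hD : ∀ v, degIn G Finset.univ v ≤ D) (φ : V → Fin 5)
    (hφ : ∀ ⦃x y⦄, G.Adj x y → φ x ≠ φ y) : TotalColorable G (D + 3) := by
  obtain ⟨c, hc, hcD⟩ := exists_properEdgeColoring G hD
  have hcD' : ∀ e ∈ G.edgeSet, c e ≤ D := by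
    intro e
    induction e with | _ x y => exact fun h => hcD x y h
  obtain ⟨E, hE⟩ : ∃ E : Finset (Sym2 V), ∀ e, e ∈ E ↔ e ∈ G.edgeSet :=
    ⟨Finset.univ.filter _, fun e => Finset.mem_filter.trans (and_iff_right (Finset.mem_univ e))⟩
  obtain ⟨Z, hZ⟩ : ∃ Z : Finset V, ∀ z, z ∈ Z ↔
      φ z = 4 ∧ ∀ m, 2 ≤ m → m ≤ D → ∃ x, G.Adj z x ∧ c s(z, x) = m :=
    ⟨Finset.univ.filter _, fun z => Finset.mem_filter.trans (and_iff_right (Finset.mem_univ z))⟩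
  have hw : ∀ z, ∃ x, z ∈ Z → G.Adj z x ∧ c s(z, x) = 2 := by
    intro z
    by_cases hz : z ∈ Z
    · obtain ⟨x, hx⟩ := ((hZ z).1 hz).2 2 le_rfl hD2
      exact ⟨x, fun _ => hx⟩
    · exact ⟨z, fun h => absurd h hz⟩
  choose w hw using hw
  have hbad : BadVertices E c Z w :=
    { proper := fun e he f hf u hue huf hef =>
        hc.eq_of_mem ((hE e).1 he) ((hE f).1 hf) hue huf hef
      mem := fun z hz => (hE _).2 (hw z hz).1
      color := fun z hz => (hw z hz).2
      ne := fun z hz y hy h => hφ (hw z hz).1 (by rw [h, ((hZ z).1 hz).1, ((hZ y).1 hy).1])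
      indep := fun z hz e he hze y hy hye => by
        by_contra hne
        obtain rfl := (Sym2.mem_and_mem_iff hne).1 ⟨hye, hze⟩
        exact hφ ((hE _).1 he) (by rw [((hZ z).1 hz).1, ((hZ y).1 hy).1])
      unique := fun z hz e he f hf hze hzf hce hcf => by
        by_contra hne
        rw [hE] at he hf
        have hne' : c e ≠ c f := fun h => hne (hc.eq_of_mem he hf hze hzf h)
        have := Finset.card_le_card_of_surjOn (s := Finset.univ.filter (G.Adj z))
          (t := Finset.range (D + 1)) (fun x => c s(z, x)) (fun m hm => by
            have hm' : m ≤ D := Nat.lt_succ_iff.1 (Finset.mem_range.1 (Finset.mem_coe.1 hm))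
            suffices ∃ x, G.Adj z x ∧ c s(z, x) = m by
              obtain ⟨x, hx, hxm⟩ := this
              exact ⟨x, by simpa using hx, hxm⟩
            by_cases hm2 : 2 ≤ m
            · exact ((hZ z).1 hz).2 m hm2 hm'
            · obtain ⟨x, rfl⟩ := hze
              obtain ⟨y, rfl⟩ := hzf
              by_cases hm1 : c s(z, x) = m
              · exact ⟨x, he, hm1⟩
              · exact ⟨y, hf, by omega⟩)
        rw [Finset.card_range] at this
        have h2 := hD z
        rw [degIn] at h2
        omega }
  obtain ⟨L, hL⟩ : ∃ L : Sym2 V → Finset ℕ, ∀ e k, k ∈ L e ↔ k < 4 ∧ ∀ u ∈ e, (φ u : ℕ) ≠ k :=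
    ⟨fun e => (Finset.range 4).filter fun k => ∀ u ∈ e, (φ u : ℕ) ≠ k, fun e k => by rw [Finset.mem_filter, Finset.mem_range]⟩
  have hcard : ∀ (T : Finset ℕ) e, (∀ u ∈ e, (φ u : ℕ) < 4 → (φ u : ℕ) ∈ T) →
      4 - T.card ≤ (L e).card := by
    intro T e hT
    refine le_trans ?_ (Finset.card_le_card (s := Finset.range 4 \ T) fun k hk => ?_)
    · exact Finset.le_card_sdiff T (Finset.range 4)
    · rw [Finset.mem_sdiff, Finset.mem_range] at hk
      exact (hL e k).2 ⟨hk.1, fun u hu hk' => hk.2 (hk' ▸ hT u hu (hk' ▸ hk.1))⟩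
  obtain ⟨ψ, hψ⟩ := hbad.exists_edgeListColoring (L := L)
    (fun e _ => by
      induction e with | _ x y =>
      have h1 := hcard {(φ x : ℕ), (φ y : ℕ)} s(x, y) (by
        intro u hu _
        rcases Sym2.mem_iff.1 hu with rfl | rfl <;> simp)
      have h2 := Finset.card_le_two (a := (φ x : ℕ)) (b := (φ y : ℕ))
      omega)
    (fun z hz e _ hze => by
      obtain ⟨x, rfl⟩ := hze
      have h1 := hcard {(φ x : ℕ)} s(z, x) (by
        intro u hu h4
        rcases Sym2.mem_iff.1 hu with rfl | rfl
        · rw [((hZ u).1 hz).1] at h4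
          exact absurd h4 (by decide)
        · simp)
      rw [Finset.card_singleton] at h1
      omega)
  obtain ⟨R, hR⟩ : ∃ R : Finset (Sym2 V), ∀ e, e ∈ R ↔
      e ∈ G.edgeSet ∧ (c e ≤ 1 ∨ ∃ z ∈ Z, e = s(z, w z)) :=
    ⟨E.filter _, fun e => by rw [← hE]; exact Finset.mem_filter⟩
  have hRE : ∀ e ∈ R, e ∈ BadVertices.edges E c Z w Z := by
    intro e he
    rw [hR] at he
    refine BadVertices.mem_edges.2 ⟨(hE e).2 he.1, he.2.imp_left fun h => ⟨h, fun z hz _ => hz⟩⟩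
  have hgood : ∀ v, ∃ m, φ v = 4 → v ∉ Z → 2 ≤ m ∧ m ≤ D ∧ ∀ x, G.Adj v x → c s(v, x) ≠ m := by
    intro v
    by_contra! hcon
    refine (hcon 0).2.1 ((hZ v).2 ⟨(hcon 0).1, fun m hm hmD => ?_⟩)
    obtain ⟨-, -, h⟩ := hcon m
    exact h hm hmD
  choose m hm using hgood
  have hψ4 : ∀ e ∈ R, ψ e < 4 := fun e he => ((hL e _).1 (hψ e (hRE e he)).1).1
  have hcR : ∀ e ∈ G.edgeSet, e ∉ R → 2 ≤ c e := by
    intro e he heR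
    by_contra hlt
    exact heR ((hR e).2 ⟨he, Or.inl (by omega)⟩)
  have hφ4 : ∀ v, (φ v : ℕ) < 4 ∨ φ v = 4 := by
    intro v
    rcases Nat.lt_or_ge (φ v : ℕ) 4 with h | h
    · exact Or.inl h
    · exact Or.inr (Fin.ext (by have := (φ v).2; simp only [Fin.isValue, Fin.coe_ofNat_eq_mod]; omega))
  obtain ⟨cv, hcv1, hcv2, hcv3⟩ : ∃ cv : V → ℕ, (∀ v, (φ v : ℕ) < 4 → cv v = φ v) ∧
      (∀ v ∈ Z, cv v = 4) ∧ ∀ v, φ v = 4 → v ∉ Z → cv v = m v + 2 := by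
    refine ⟨fun v => if (φ v : ℕ) < 4 then φ v else if v ∈ Z then 4 else m v + 2,
      fun v hv => if_pos hv, fun v hv => ?_, fun v hv hvZ => ?_⟩
    · simp [((hZ v).1 hv).1, hv]
    · simp [hv, hvZ]
  obtain ⟨ce, hce1, hce2⟩ : ∃ ce : Sym2 V → ℕ, (∀ e ∈ R, ce e = ψ e) ∧ ∀ e ∉ R, ce e = c e + 2 :=
    ⟨fun e => if e ∈ R then ψ e else c e + 2, fun e he => if_pos he, fun e he => if_neg he⟩
  have hcv4 : ∀ v, φ v = 4 → 4 ≤ cv v := by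
    intro v hv
    by_cases hvZ : v ∈ Z
    · rw [hcv2 v hvZ]
    · rw [hcv3 v hv hvZ]
      have := (hm v hv hvZ).1
      omega
  have hev : ∀ u x, G.Adj u x → ce s(u, x) ≠ cv u := by
    intro u x hux
    by_cases hR' : s(u, x) ∈ R
    · rw [hce1 _ hR']
      have h4 := hψ4 _ hR'
      rcases hφ4 u with hu | hu
      · rw [hcv1 u hu]
        exact (((hL _ _).1 (hψ _ (hRE _ hR')).1).2 u (Sym2.mem_mk_left _ _)).symm
      · have := hcv4 u hu
        omega
    · rw [hce2 _ hR']
      have h2 := hcR _ hux hR'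
      rcases hφ4 u with hu | hu
      · rw [hcv1 u hu]
        omega
      · by_cases huZ : u ∈ Z
        · rw [hcv2 u huZ]
          intro h
          refine hR' ((hR _).2 ⟨hux, Or.inr ⟨u, huZ, ?_⟩⟩)
          exact hc.eq_of_mem hux (hw u huZ).1 (Sym2.mem_mk_left _ _) (Sym2.mem_mk_left _ _)
            ((hw u huZ).2 ▸ by omega)
        · rw [hcv3 u hu huZ]
          have := (hm u hu huZ).2.2 x hux
          omega
  refine ⟨cv, ce, ⟨fun u v huv => ?_, fun u v x huv hux hne => ?_, fun u v huv => ⟨hev u v huv, ?_⟩⟩,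
    fun v => ?_, fun e he => ?_⟩
  · have hne := hφ huv
    rcases hφ4 u with hu | hu <;> rcases hφ4 v with hv | hv
    · rw [hcv1 u hu, hcv1 v hv]
      exact fun h => hne (Fin.ext h)
    · rw [hcv1 u hu]
      have := hcv4 v hv
      omega
    · rw [hcv1 v hv]
      have := hcv4 u hu
      omega
    · exact absurd (hu.trans hv.symm) hne
  · have hne' : s(u, v) ≠ s(u, x) := fun h => hne (Sym2.congr_right.1 h)
    have hcc := hc huv hux hne
    by_cases h1 : s(u, v) ∈ R <;> by_cases h2 : s(u, x) ∈ R
    · rw [hce1 _ h1, hce1 _ h2]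
      exact (hψ _ (hRE _ h1)).2 _ (hRE _ h2) hne' ⟨u, Sym2.mem_mk_left _ _, Sym2.mem_mk_left _ _⟩
    · rw [hce1 _ h1, hce2 _ h2]
      have := hψ4 _ h1
      have := hcR _ hux h2
      omega
    · rw [hce2 _ h1, hce1 _ h2]
      have := hψ4 _ h2
      have := hcR _ huv h1
      omega
    · rw [hce2 _ h1, hce2 _ h2]
      omega
  · rw [Sym2.eq_swap]
    exact hev v u huv.symm
  · rcases hφ4 v with hv | hv
    · rw [hcv1 v hv]
      omega
    · by_cases hvZ : v ∈ Z
      · rw [hcv2 v hvZ]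
        omega
      · rw [hcv3 v hv hvZ]
        have := hm v hv hvZ
        omega
  · by_cases h : e ∈ R
    · rw [hce1 e h]
      have := hψ4 e h
      omega
    · rw [hce2 e h]
      have := hcD' e he
      omega

end

set_option synthInstance.maxSize 2000 in
theorem exists_path_colors (p q r s : Fin 4) : ∃ xa xab xb xbc : Fin 4,
    xa ≠ p ∧ xa ≠ q ∧ xab ≠ q ∧ xb ≠ r ∧ xbc ≠ r ∧ xbc ≠ s ∧ xab ≠ xbc ∧ xab ≠ xb ∧ xab ≠ xa ∧
      xa ≠ xb ∧ xbc ≠ xb := by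
  have key : ∀ p q r s : Fin 4, ∃ xa : Fin 4, (xa ≠ p ∧ xa ≠ q) ∧ ∃ xab : Fin 4,
      (xab ≠ q ∧ xab ≠ xa) ∧ ∃ xb : Fin 4, (xb ≠ r ∧ xab ≠ xb ∧ xa ≠ xb) ∧
        ∃ xbc : Fin 4, xbc ≠ r ∧ xbc ≠ s ∧ xab ≠ xbc ∧ xbc ≠ xb := by
    decide
  obtain ⟨xa, h1, xab, h2, xb, h3, xbc, h4⟩ := key p q r s
  exact ⟨xa, xab, xb, xbc, h1.1, h1.2, h2.1, h3.1, h4.1, h4.2.1, h4.2.2.1, h3.2.1, h2.2, h3.2.2,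
    h4.2.2.2⟩

section

open scoped Classical

variable {V : Type*}

theorem TotalColorable.mono {G : SimpleGraph V} {k l : ℕ} (hkl : k ≤ l)
    (h : TotalColorable G k) : TotalColorable G l := by
  obtain ⟨cv, ce, h1, h2, h3⟩ := h
  exact ⟨cv, ce, h1, fun v => (h2 v).trans_le hkl, fun e he => (h3 e he).trans_le hkl⟩

theorem deleteEdges_lt {G : SimpleGraph V} {u v : V} (huv : G.Adj u v) :
    G.deleteEdges {s(u, v)} < G :=
  lt_of_le_of_ne (G.deleteEdges_le _) fun h => by
    have := h.symm ▸ huv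
    rw [SimpleGraph.deleteEdges_adj] at this
    exact this.2 rfl

/-- Adding the edge `uv` with colour `b` and changing the colour of `u` to `a`. -/
theorem IsTotalColoring.update {G : SimpleGraph V} {u v : V} (huv : G.Adj u v) {cv : V → ℕ}
    {ce : Sym2 V → ℕ} (h : IsTotalColoring (G.deleteEdges {s(u, v)}) cv ce) {a b : ℕ}
    (hbu : ∀ x, G.Adj u x → x ≠ v → b ≠ ce s(u, x)) (hbv : ∀ x, G.Adj v x → x ≠ u → b ≠ ce s(v, x))
    (hb : b ≠ cv v) (hab : b ≠ a) (hav : ∀ x, G.Adj u x → a ≠ cv x)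
    (hae : ∀ x, G.Adj u x → x ≠ v → a ≠ ce s(u, x)) :
    IsTotalColoring G (Function.update cv u a) (Function.update ce s(u, v) b) := by
  have hadj : ∀ x y, G.Adj x y → s(x, y) ≠ s(u, v) → (G.deleteEdges {s(u, v)}).Adj x y :=
    fun x y hxy hne => SimpleGraph.deleteEdges_adj.2 ⟨hxy, hne⟩
  have hbe : ∀ x y, G.Adj x y → s(x, y) ≠ s(u, v) → x ∈ s(u, v) → b ≠ ce s(x, y) := by
    intro x y hxy hne hx
    rcases Sym2.mem_iff.1 hx with rfl | rfl
    · exact hbu y hxy fun hy => hne (by rw [hy])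
    · exact hbv y hxy fun hy => hne (by rw [hy, Sym2.eq_swap])
  have hev : ∀ x y, G.Adj x y →
      Function.update ce s(u, v) b s(x, y) ≠ Function.update cv u a x := by
    intro x y hxy
    by_cases he : s(x, y) = s(u, v)
    · rw [he, Function.update_self]
      by_cases hx : x = u
      · rw [hx, Function.update_self]
        exact hab
      · rw [Function.update_of_ne hx]
        rcases Sym2.eq_iff.1 he with ⟨rfl, -⟩ | ⟨rfl, -⟩
        · exact absurd rfl hx
        · exact hb
    · rw [Function.update_of_ne he]
      by_cases hx : x = u
      · subst hx
        rw [Function.update_self]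
        exact (hae y hxy fun hy => he (by rw [hy])).symm
      · rw [Function.update_of_ne hx]
        exact (h.2.2 (hadj x y hxy he)).1
  refine ⟨fun x y hxy => ?_, fun x y z hxy hxz hyz => ?_, fun x y hxy => ⟨hev x y hxy, ?_⟩⟩
  · by_cases hx : x = u
    · subst hx
      rw [Function.update_self, Function.update_of_ne hxy.ne.symm]
      exact hav y hxy
    by_cases hy : y = u
    · subst hy
      rw [Function.update_self, Function.update_of_ne hx]
      exact (hav x hxy.symm).symm
    rw [Function.update_of_ne hx, Function.update_of_ne hy]
    refine h.1 (hadj x y hxy fun he => ?_)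
    have : u ∈ s(x, y) := he ▸ Sym2.mem_mk_left _ _
    rcases Sym2.mem_iff.1 this with h | h
    · exact hx h.symm
    · exact hy h.symm
  · have hne : s(x, y) ≠ s(x, z) := fun h => hyz (Sym2.congr_right.1 h)
    by_cases h1 : s(x, y) = s(u, v)
    · have h2 : s(x, z) ≠ s(u, v) := fun h => hne (h1.trans h.symm)
      rw [h1, Function.update_self, Function.update_of_ne h2]
      exact hbe x z hxz h2 (h1 ▸ Sym2.mem_mk_left _ _)
    by_cases h2 : s(x, z) = s(u, v)
    · rw [h2, Function.update_self, Function.update_of_ne h1]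
      exact (hbe x y hxy h1 (h2 ▸ Sym2.mem_mk_left _ _)).symm
    rw [Function.update_of_ne h1, Function.update_of_ne h2]
    exact h.2.1 (hadj x y hxy h1) (hadj x z hxz h2) hyz
  · rw [Sym2.eq_swap (a := x)]
    exact hev y x hxy.symm

theorem update_lt {α : Type*} [DecidableEq α] {f : α → ℕ} {k a : ℕ} {x : α} {P : α → Prop} (ha : a < k)
    (hf : ∀ y, P y → y ≠ x → f y < k) : ∀ y, P y → Function.update f x a y < k := by
  intro y hy
  by_cases h : y = x
  · rwa [h, Function.update_self]
  · rw [Function.update_of_ne h]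
    exact hf y hy h

theorem exists_lt_notMem {k : ℕ} {T : Finset ℕ} (hT : T.card < k) : ∃ a < k, a ∉ T := by
  obtain ⟨a, ha, haT⟩ := Finset.exists_mem_notMem_of_card_lt_card
    (s := T) (t := Finset.range k) (by rwa [Finset.card_range])
  exact ⟨a, Finset.mem_range.1 ha, haT⟩

theorem card_filter_adj_ne [Fintype V] {G : SimpleGraph V} {u v : V} (huv : G.Adj u v) :
    (Finset.univ.filter fun x => G.Adj u x ∧ x ≠ v).card + 1 = degIn G Finset.univ u := by
  rw [degIn, ← Finset.card_erase_add_one (s := Finset.univ.filter fun x => G.Adj u x) (a := v)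
    (by simpa using huv)]
  congr 2
  ext x
  simp [and_comm]

theorem TotalColorable.of_deleteEdges [Fintype V] {G : SimpleGraph V} {k : ℕ} {u v : V}
    (huv : G.Adj u v) (hk : degIn G Finset.univ u + degIn G Finset.univ v ≤ k)
    (hu : 2 * degIn G Finset.univ u < k) (h : TotalColorable (G.deleteEdges {s(u, v)}) k) :
    TotalColorable G k := by
  obtain ⟨cv, ce, h, hcv, hce⟩ := h
  have hU := card_filter_adj_ne huv
  have hV := card_filter_adj_ne huv.symm
  obtain ⟨NU, hNU⟩ : ∃ N, N = Finset.univ.filter fun x => G.Adj u x ∧ x ≠ v := ⟨_, rfl⟩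
  obtain ⟨NV, hNV⟩ : ∃ N, N = Finset.univ.filter fun x => G.Adj v x ∧ x ≠ u := ⟨_, rfl⟩
  rw [← hNU] at hU
  rw [← hNV] at hV
  have mU : ∀ x, G.Adj u x → x ≠ v → x ∈ NU := by
    intro x h1 h2
    simp [hNU, h1, h2]
  have mV : ∀ x, G.Adj v x → x ≠ u → x ∈ NV := by
    intro x h1 h2
    simp [hNV, h1, h2]
  obtain ⟨b, hbk, hb⟩ := exists_lt_notMem (k := k)
    (T := insert (cv v) (NU.image (fun x => ce s(u, x)) ∪ NV.image fun x => ce s(v, x))) (by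
      refine (Finset.card_insert_le _ _).trans_lt ?_
      have h1 := Finset.card_union_le (NU.image (fun x => ce s(u, x))) (NV.image fun x => ce s(v, x))
      have h2 := Finset.card_image_le (s := NU) (f := fun x => ce s(u, x))
      have h3 := Finset.card_image_le (s := NV) (f := fun x => ce s(v, x))
      omega)
  obtain ⟨a, hak, ha⟩ := exists_lt_notMem (k := k)
    (T := insert b (insert (cv v) (NU.image (fun x => ce s(u, x)) ∪ NU.image cv))) (by
      refine (Finset.card_insert_le _ _).trans_lt ?_
      have h0 := Finset.card_insert_le (cv v) (NU.image (fun x => ce s(u, x)) ∪ NU.image cv)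
      have h1 := Finset.card_union_le (NU.image (fun x => ce s(u, x))) (NU.image cv)
      have h2 := Finset.card_image_le (s := NU) (f := fun x => ce s(u, x))
      have h3 := Finset.card_image_le (s := NU) (f := cv)
      omega)
  simp only [Finset.mem_insert, Finset.mem_union, Finset.mem_image, not_or, not_exists,
    not_and] at ha hb
  refine ⟨_, _, h.update huv (a := a) (b := b) (fun x h1 h2 h3 => hb.2.1 x (mU x h1 h2) h3.symm)
    (fun x h1 h2 h3 => hb.2.2 x (mV x h1 h2) h3.symm) hb.1 (Ne.symm ha.1) (fun x h1 h2 => ?_)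
    (fun x h1 h2 h3 => ha.2.2.1 x (mU x h1 h2) h3.symm),
    fun x => update_lt (P := fun _ => True) hak (fun y _ _ => hcv y) x trivial,
    update_lt hbk fun e he hne => hce e ?_⟩
  · by_cases hx : x = v
    · exact ha.2.1 (hx ▸ h2)
    · exact ha.2.2.2 x (mU x h1 hx) h2.symm
  · rw [SimpleGraph.edgeSet_deleteEdges]
    exact ⟨he, hne⟩

theorem totalColorable_four [Fintype V] (G : SimpleGraph V)
    (hG : ∀ v, degIn G Finset.univ v ≤ 2) : TotalColorable G 4 := by
  induction G using WellFoundedLT.induction with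
  | _ G ih =>
  have ih' : ∀ G' < G, TotalColorable G' 4 := fun G' hG' => ih G' hG' fun v =>
    (Finset.card_le_card fun x hx => by
      rw [Finset.mem_filter] at hx ⊢
      exact ⟨hx.1, hG'.le hx.2⟩).trans (hG v)
  by_cases h1 : ∃ u v, G.Adj u v ∧ degIn G Finset.univ u ≤ 1
  · obtain ⟨u, v, huv, hu⟩ := h1
    have := hG v
    exact (ih' _ (deleteEdges_lt huv)).of_deleteEdges huv (by omega) (by omega)
  push Not at h1
  have hnbr : ∀ u v, G.Adj u v → ∃ x, x ≠ v ∧ G.Adj u x ∧ ∀ y, G.Adj u y → y ≠ v → y = x := by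
    intro u v huv
    have e1 := card_filter_adj_ne huv
    have e2 := h1 u v huv
    have e3 := hG u
    obtain ⟨x, hx⟩ := Finset.card_eq_one.1 (by omega :
      (Finset.univ.filter fun x => G.Adj u x ∧ x ≠ v).card = 1)
    have hx' := fun y => Finset.ext_iff.1 hx y
    simp only [Finset.mem_filter, Finset.mem_univ, true_and, Finset.mem_singleton] at hx'
    have := (hx' x).2 rfl
    exact ⟨x, this.2, this.1, fun y h1 h2 => (hx' y).1 ⟨h1, h2⟩⟩
  by_cases h0 : ∃ a b, G.Adj a b
  · obtain ⟨a, b, hab⟩ := h0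
    obtain ⟨p, hpb, hap, hp⟩ := hnbr a b hab
    obtain ⟨c, hca, hbc, hc⟩ := hnbr b a hab.symm
    obtain ⟨q, hqb, hcq, hq⟩ := hnbr c b hbc.symm
    have hbc' : (G.deleteEdges {s(a, b)}).Adj b c := by
      rw [SimpleGraph.deleteEdges_adj]
      refine ⟨hbc, fun h => ?_⟩
      rcases Sym2.eq_iff.1 h with ⟨h1, -⟩ | ⟨-, h1⟩
      · exact hab.ne h1.symm
      · exact hca h1
    have hle : ∀ {x y}, (G.deleteEdges {s(a, b)}).Adj x y → G.Adj x y :=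
      fun h => G.deleteEdges_le _ h
    have hne : ∀ {y}, (G.deleteEdges {s(a, b)}).Adj b y → y = c := fun {y} h => by
      refine hc y (hle h) fun hya => ?_
      rw [SimpleGraph.deleteEdges_adj, hya] at h
      exact h.2 Sym2.eq_swap
    have hlt := deleteEdges_lt hbc'
    obtain ⟨cv, ce, h, hcv, hce⟩ := ih' _ (hlt.trans (deleteEdges_lt hab))
    have hapE : s(a, p) ∈ ((G.deleteEdges {s(a, b)}).deleteEdges {s(b, c)}).edgeSet := by
      rw [SimpleGraph.mem_edgeSet, SimpleGraph.deleteEdges_adj, SimpleGraph.deleteEdges_adj]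
      refine ⟨⟨hap, fun h => hpb (Sym2.congr_right.1 h)⟩, fun h => ?_⟩
      rcases Sym2.eq_iff.1 h with ⟨h1, -⟩ | ⟨h1, -⟩
      · exact hab.ne h1
      · exact hca h1.symm
    have hcqE : s(c, q) ∈ ((G.deleteEdges {s(a, b)}).deleteEdges {s(b, c)}).edgeSet := by
      rw [SimpleGraph.mem_edgeSet, SimpleGraph.deleteEdges_adj, SimpleGraph.deleteEdges_adj]
      refine ⟨⟨hcq, fun h => ?_⟩, fun h => ?_⟩
      · rcases Sym2.eq_iff.1 h with ⟨h1, -⟩ | ⟨h1, -⟩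
        · exact hca h1
        · exact hbc.ne h1.symm
      · rcases Sym2.eq_iff.1 h with ⟨h1, -⟩ | ⟨-, h1⟩
        · exact hbc.ne h1.symm
        · exact hqb h1
    obtain ⟨xa, xab, xb, xbc, k1, k2, k3, k4, k5, k6, k7, k8, k9, k10, k11⟩ :=
      exists_path_colors ⟨cv p, hcv p⟩ ⟨ce s(a, p), hce _ hapE⟩ ⟨cv c, hcv c⟩ ⟨ce s(c, q), hce _ hcqE⟩
    simp only [ne_eq, Fin.ext_iff] at k1 k2 k3 k4 k5 k6 k7 k8 k9 k10 k11
    have h2 := h.update hbc' (a := xb) (b := xbc) (fun x h1 h2 => absurd (hne h1) h2)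
      (fun x h1 h2 => by rw [hq x (hle h1) h2]; exact k6) k5 k11
      (fun x h1 => by rw [hne h1]; exact k4) (fun x h1 h2 => absurd (hne h1) h2)
    have ep : Function.update ce s(b, c) xbc s(a, p) = ce s(a, p) := by
      refine Function.update_of_ne (fun h => ?_) _ _
      rcases Sym2.eq_iff.1 h with ⟨h1, -⟩ | ⟨h1, -⟩
      · exact hab.ne h1
      · exact hca h1.symm
    refine ⟨_, _, h2.update hab (a := xa) (b := xab) (fun x h1 h2 => ?_) (fun x h1 h2 => ?_) ?_ k9
      (fun x h1 => ?_) (fun x h1 h2 => ?_),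
      fun x => update_lt (P := fun _ => True) xa.2 (fun y _ _ =>
        update_lt (P := fun _ => True) xb.2 (fun y _ _ => hcv y) y trivial) x trivial,
      update_lt xab.2 fun e he hne => update_lt (P := (· ∈ (G.deleteEdges {s(a, b)}).edgeSet)) xbc.2
        (fun e he hne => hce e ?_) e ?_⟩
    · rw [hp x h1 h2, ep]
      exact k3
    · rw [hc x h1 h2, Function.update_self]
      exact k7
    · rw [Function.update_self]
      exact k8
    · by_cases hx : x = b
      · rw [hx, Function.update_self]
        exact k10
      · rw [Function.update_of_ne hx, hp x h1 hx]
        exact k1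
    · rw [hp x h1 h2, ep]
      exact k2
    · rw [SimpleGraph.edgeSet_deleteEdges]
      exact ⟨he, hne⟩
    · rw [SimpleGraph.edgeSet_deleteEdges]
      exact ⟨he, hne⟩
  · push Not at h0
    refine ⟨fun _ => 0, fun _ => 0, ⟨fun u v h => absurd h (h0 u v),
      fun u v _ h => absurd h (h0 u v), fun u v h => absurd h (h0 u v)⟩, fun _ => Nat.zero_lt_succ 3,
      fun _ _ => Nat.zero_lt_succ 3⟩

theorem exists_perm_avoid {k p₁ p₂ : ℕ} (A₁ A₂ : Finset ℕ) (hp₁ : p₁ < k) (hp₂ : p₂ < k)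
    (h₂ : p₂ ∉ A₂) (hA : ∀ a ∈ A₂, a < k) (hk : A₁.card + A₂.card < k) :
    ∃ σ : Equiv.Perm ℕ, (∀ i < k, σ i < k) ∧ σ p₂ = p₁ ∧ ∀ a ∈ A₂, σ a ∉ A₁ := by
  have hswap : ∀ {a b : ℕ}, a < k → b < k → ∀ i < k, Equiv.swap a b i < k := by
    intro a b ha hb i hi
    rw [Equiv.swap_apply_def]
    split_ifs
    exacts [hb, ha, hi]
  induction A₂ using Finset.induction_on with
  | empty => exact ⟨Equiv.swap p₂ p₁, hswap hp₂ hp₁, Equiv.swap_apply_left _ _, by simp⟩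
  | insert a A₂ ha ih =>
    rw [Finset.card_insert_of_notMem ha] at hk
    rw [Finset.mem_insert, not_or] at h₂
    have hak := hA a (Finset.mem_insert_self _ _)
    obtain ⟨σ, hσ, hσp, hσA⟩ := ih h₂.2 (fun b hb => hA b (Finset.mem_insert_of_mem hb)) (by omega)
    obtain ⟨b, hbk, hb⟩ := exists_lt_notMem (k := k) (T := insert p₁ (A₁ ∪ A₂.image σ)) (by
      refine (Finset.card_insert_le _ _).trans_lt ?_
      have h1 := Finset.card_union_le A₁ (A₂.image σ)
      have h2 := Finset.card_image_le (s := A₂) (f := σ)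
      omega)
    simp only [Finset.mem_insert, Finset.mem_union, Finset.mem_image, not_or, not_exists,
      not_and] at hb
    refine ⟨σ.trans (Equiv.swap (σ a) b), fun i hi => hswap (hσ a hak) hbk _ (hσ i hi), ?_, ?_⟩
    · rw [Equiv.trans_apply, hσp, Equiv.swap_apply_of_ne_of_ne _ (Ne.symm hb.1)]
      rw [← hσp]
      exact fun h => h₂.1 (σ.injective h)
    · intro x hx
      rw [Equiv.trans_apply]
      rcases Finset.mem_insert.1 hx with rfl | hx
      · rw [Equiv.swap_apply_left]
        exact hb.2.1
      · have hxa : σ x ≠ σ a := fun h => ha (σ.injective h ▸ hx)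
        rw [Equiv.swap_apply_of_ne_of_ne hxa (hb.2.2 x hx)]
        exact hσA x hx

theorem TotalColorable.of_cut [Fintype V] {G : SimpleGraph V} {k : ℕ} {v : V} {S : Set V}
    (hv : v ∉ S) (hS : ∀ x ∈ S, ∀ y, G.Adj x y → y ∈ S ∨ y = v)
    (hk : degIn G Finset.univ v < k) (h₁ : TotalColorable (within G (insert v S)) k)
    (h₂ : TotalColorable (within G Sᶜ) k) : TotalColorable G k := by
  obtain ⟨cv₁, ce₁, h₁, hcv₁, hce₁⟩ := h₁
  obtain ⟨cv₂, ce₂, h₂, hcv₂, hce₂⟩ := h₂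
  have adj₁ : ∀ {x y}, G.Adj x y → x ∈ S ∨ y ∈ S → (within G (insert v S)).Adj x y := by
    rintro x y hxy (h | h)
    · exact ⟨hxy, Or.inr h, (hS x h y hxy).symm⟩
    · exact ⟨hxy, (hS y h x hxy.symm).symm, Or.inr h⟩
  have adj₂ : ∀ {x y}, G.Adj x y → ¬ (x ∈ S ∨ y ∈ S) → (within G Sᶜ).Adj x y :=
    fun hxy h => ⟨hxy, fun hx => h (Or.inl hx), fun hy => h (Or.inr hy)⟩
  obtain ⟨σ, hσ, hσv, hσA⟩ := exists_perm_avoid (k := k) (p₁ := cv₁ v) (p₂ := cv₂ v)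
    ((Finset.univ.filter fun x => G.Adj v x ∧ x ∈ S).image fun x => ce₁ s(v, x))
    ((Finset.univ.filter fun x => G.Adj v x ∧ x ∉ S).image fun x => ce₂ s(v, x))
    (hcv₁ v) (hcv₂ v) (by
      rw [Finset.mem_image]
      rintro ⟨x, hx, hxe⟩
      rw [Finset.mem_filter] at hx
      exact (h₂.2.2 (adj₂ hx.2.1 (not_or.2 ⟨hv, hx.2.2⟩))).1 hxe) (by
      intro a ha
      rw [Finset.mem_image] at ha
      obtain ⟨x, hx, rfl⟩ := ha
      rw [Finset.mem_filter] at hx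
      exact hce₂ _ (adj₂ hx.2.1 (not_or.2 ⟨hv, hx.2.2⟩))) (by
      refine (Nat.add_le_add Finset.card_image_le Finset.card_image_le).trans_lt (lt_of_eq_of_lt ?_ hk)
      rw [degIn, ← Finset.card_filter_add_card_filter_not (s := Finset.univ.filter fun x => G.Adj v x)
        (fun x => x ∈ S), Finset.filter_filter, Finset.filter_filter])
  obtain ⟨cv, hcvS, hcv⟩ : ∃ cv : V → ℕ, (∀ x ∈ S, cv x = cv₁ x) ∧ ∀ x ∉ S, cv x = σ (cv₂ x) :=
    ⟨fun x => if x ∈ S then cv₁ x else σ (cv₂ x), fun x hx => if_pos hx, fun x hx => if_neg hx⟩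
  obtain ⟨ce, hceS, hce⟩ : ∃ ce : Sym2 V → ℕ, (∀ x y, x ∈ S ∨ y ∈ S → ce s(x, y) = ce₁ s(x, y)) ∧
      ∀ x y, ¬ (x ∈ S ∨ y ∈ S) → ce s(x, y) = σ (ce₂ s(x, y)) :=
    ⟨fun e => if ∃ x ∈ e, x ∈ S then ce₁ e else σ (ce₂ e), fun x y h => if_pos (by simpa using h),
      fun x y h => if_neg (by simpa using h)⟩
  have hcvS' : ∀ x, x ∈ S ∨ x = v → cv x = cv₁ x := by
    rintro x (hx | rfl)
    · exact hcvS x hx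
    · rw [hcv x hv, hσv]
  have hmix : ∀ x y z, G.Adj x y → G.Adj x z → x ∈ S ∨ y ∈ S → ¬ (x ∈ S ∨ z ∈ S) →
      ce₁ s(x, y) ≠ σ (ce₂ s(x, z)) := by
    intro x y z hxy hxz h h'
    rw [not_or] at h'
    have hy := h.resolve_left h'.1
    obtain rfl := (hS y hy x hxy.symm).resolve_left h'.1
    intro heq
    refine hσA (ce₂ s(x, z)) (Finset.mem_image.2 ⟨z, by simp [hxz, h'.2], rfl⟩) ?_
    exact Finset.mem_image.2 ⟨y, by simp [hxy, hy], heq⟩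
  have hev : ∀ x y, G.Adj x y → ce s(x, y) ≠ cv x := by
    intro x y hxy
    by_cases h : x ∈ S ∨ y ∈ S
    · rw [hceS x y h, hcvS' x (((adj₁ hxy h).2.1).symm)]
      exact (h₁.2.2 (adj₁ hxy h)).1
    · rw [hce x y h, hcv x fun hx => h (Or.inl hx)]
      exact fun heq => (h₂.2.2 (adj₂ hxy h)).1 (σ.injective heq)
  refine ⟨cv, ce, ⟨fun x y hxy => ?_, fun x y z hxy hxz hyz => ?_, fun x y hxy => ⟨hev x y hxy, ?_⟩⟩,
    fun x => ?_, fun e => ?_⟩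
  · by_cases h : x ∈ S ∨ y ∈ S
    · rw [hcvS' x (((adj₁ hxy h).2.1).symm), hcvS' y (((adj₁ hxy h).2.2).symm)]
      exact h₁.1 (adj₁ hxy h)
    · rw [hcv x fun hx => h (Or.inl hx), hcv y fun hy => h (Or.inr hy)]
      exact fun heq => h₂.1 (adj₂ hxy h) (σ.injective heq)
  · by_cases h : x ∈ S ∨ y ∈ S <;> by_cases h' : x ∈ S ∨ z ∈ S
    · rw [hceS x y h, hceS x z h']
      exact h₁.2.1 (adj₁ hxy h) (adj₁ hxz h') hyz
    · rw [hceS x y h, hce x z h']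
      exact hmix x y z hxy hxz h h'
    · rw [hce x y h, hceS x z h']
      exact (hmix x z y hxz hxy h' h).symm
    · rw [hce x y h, hce x z h']
      exact fun heq => h₂.2.1 (adj₂ hxy h) (adj₂ hxz h') hyz (σ.injective heq)
  · rw [Sym2.eq_swap]
    exact hev y x hxy.symm
  · by_cases h : x ∈ S
    · rw [hcvS x h]
      exact hcv₁ x
    · rw [hcv x h]
      exact hσ _ (hcv₂ x)
  · induction e with | _ x y =>
    intro hxy
    by_cases h : x ∈ S ∨ y ∈ S
    · rw [hceS x y h]
      exact hce₁ _ (adj₁ hxy h)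
    · rw [hce x y h]
      exact hσ _ (hce₂ _ (adj₂ hxy h))

/-- The edges of `G` cannot be split at a vertex: if a set `S` avoiding `v` has no neighbours
outside `S` except possibly `v`, then `S` meets no edge or all edges. -/
def Unsplittable (G : SimpleGraph V) : Prop :=
  ∀ (v : V) (S : Set V), v ∉ S → (∀ x ∈ S, ∀ y, G.Adj x y → y ∈ S ∨ y = v) →
    ∀ x ∈ S, ∀ y, G.Adj x y → ∀ p q, G.Adj p q → p ∈ S ∨ q ∈ S

theorem unsplittable_of_not_totalColorable [Fintype V] {G : SimpleGraph V} {k : ℕ}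
    (hk : ∀ v, degIn G Finset.univ v < k) (ih : ∀ G' < G, TotalColorable G' k)
    (hG : ¬ TotalColorable G k) : Unsplittable G := by
  intro v S hv hS x hx y hxy p q hpq
  by_contra hcon
  refine hG (.of_cut hv hS (hk v) (ih _ ?_) (ih _ ?_))
  · refine lt_of_le_of_ne (fun a b h => h.1) fun h => ?_
    have := h.symm ▸ hpq
    rcases this.2.1 with rfl | hp
    · rcases this.2.2 with rfl | hq
      · exact hpq.ne rfl
      · exact hcon (Or.inr hq)
    · exact hcon (Or.inl hp)
  · refine lt_of_le_of_ne (fun a b h => h.1) fun h => ?_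
    have := h.symm ▸ hxy
    exact this.2.1 hx

theorem Unsplittable.linked {G : SimpleGraph V} (hG : Unsplittable G) {v : V}
    (hne : ({x | ∃ y, G.Adj x y} \ {v}).Nonempty) : Linked G ({x | ∃ y, G.Adj x y} \ {v}) := by
  refine ⟨hne, fun X hX hXne hXU => ?_⟩
  by_contra! hcon
  obtain ⟨y, hy, hyX⟩ : ∃ y ∈ {x | ∃ y, G.Adj x y} \ {v}, y ∉ X := by
    by_contra! hc
    exact hXU (Set.Subset.antisymm hX hc)
  obtain ⟨x, hx⟩ := hXne
  obtain ⟨z, hxz⟩ := (hX hx).1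
  obtain ⟨q, hyq⟩ := hy.1
  have h := hG v X (fun h => (hX h).2 rfl) (fun a ha b hab => by
    by_contra! hb
    exact hcon a ha b ⟨⟨a, hab.symm⟩, hb.2⟩ hb.1 hab) x hx z hxz y q hyq
  exact hcon q (h.resolve_left hyX) y hy hyX hyq.symm

theorem Unsplittable.exists_linked [Fintype V] {G : SimpleGraph V} (hG : Unsplittable G) {v : V}
    (hv : ∃ u, G.Adj v u)
    (hne : ∀ u, G.Adj v u → ({x | ∃ y, G.Adj x y} \ {v, u}).Nonempty) :
    ∃ u, G.Adj v u ∧ Linked G ({x | ∃ y, G.Adj x y} \ {v, u}) := by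
  obtain ⟨U, hU⟩ : ∃ U, U = {x | ∃ y, G.Adj x y} := ⟨_, rfl⟩
  rw [← hU] at hne ⊢
  have memU : ∀ {x y}, G.Adj x y → x ∈ U := fun {x y} h => hU ▸ ⟨y, h⟩
  by_contra! hcon
  obtain ⟨P, hP⟩ : ∃ P : V → Set V → Prop, ∀ u A, P u A ↔ G.Adj v u ∧ A ⊆ U \ {v, u} ∧
      A.Nonempty ∧ (∃ y ∈ U \ {v, u}, y ∉ A) ∧ ∀ x ∈ A, ∀ y ∈ U \ {v, u}, y ∉ A → ¬ G.Adj x y :=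
    ⟨_, fun _ _ => Iff.rfl⟩
  have hex : ∀ u, G.Adj v u → ∃ A, P u A := by
    intro u hu
    by_contra! hA
    refine hcon u hu ⟨hne u hu, fun X hX hXne hXU => ?_⟩
    by_contra! hX'
    refine hA X ((hP _ _).2 ⟨hu, hX, hXne, ?_, hX'⟩)
    by_contra! hc
    exact hXU (Set.Subset.antisymm hX hc)
  suffices ∀ (A : Set V) u, ¬ P u A by
    obtain ⟨u, hu⟩ := hv
    obtain ⟨A, hA⟩ := hex u hu
    exact this A u hA
  intro A
  induction A using WellFoundedLT.induction with
  | _ A ih =>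
  intro u huA
  obtain ⟨hvu, hAU, ⟨a, ha⟩, ⟨y, hy, hyA⟩, hclosed⟩ := (hP _ _).1 huA
  have hcl : ∀ x ∈ A, ∀ y, G.Adj x y → y ∉ A → y = v ∨ y = u := by
    intro x hx y hxy hyA
    by_contra hc
    exact hclosed x hx y ⟨memU hxy.symm, hc⟩ hyA hxy
  obtain ⟨u', hu'A, hvu'⟩ : ∃ u' ∈ A, G.Adj v u' := by
    by_contra! hc
    obtain ⟨z, haz⟩ := hU ▸ (hAU ha).1
    obtain ⟨q, hyq⟩ := hU ▸ hy.1
    have := hG u A (fun h => (hAU h).2 (Or.inr rfl)) (fun x hx y hxy => by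
      by_contra! hyA
      rcases hcl x hx y hxy hyA.1 with rfl | rfl
      · exact hc x hx hxy.symm
      · exact hyA.2 rfl) a ha z haz y q hyq
    exact hclosed q (this.resolve_left hyA) y hy hyA hyq.symm
  have huu' : u ≠ u' := fun h => (hAU hu'A).2 (Or.inr h.symm)
  obtain ⟨A', hA', huA'⟩ : ∃ A', P u' A' ∧ u ∉ A' := by
    obtain ⟨A', hA'⟩ := hex u' hvu'
    by_cases hu : u ∈ A'
    · refine ⟨(U \ {v, u'}) \ A', ?_, fun h => h.2 hu⟩
      obtain ⟨-, hAU', ⟨b, hb⟩, ⟨y, hy, hyA⟩, hclosed⟩ := (hP _ _).1 hA'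
      exact (hP _ _).2 ⟨hvu', Set.sdiff_subset, ⟨y, hy, hyA⟩, ⟨b, hAU' hb, fun h => h.2 hb⟩,
        fun x hx y hy hyA' hxy => hclosed y (by
          by_contra hc
          exact hyA' ⟨hy, hc⟩) x hx.1 hx.2 hxy.symm⟩
    · exact ⟨A', hA', hu⟩
  obtain ⟨-, hAU', -, -, hclosed'⟩ := (hP _ _).1 hA'
  have hsub : A' ⊆ A := by
    intro b hb
    by_contra hbA
    obtain ⟨z, hbz⟩ := hU ▸ (hAU' hb).1
    have := hG v (A' \ A) (fun h => (hAU' h.1).2 (Or.inl rfl)) (fun x hx y hxy => by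
      by_contra! hc
      have hyA : y ∉ A := by
        intro hyA
        rcases hcl y hyA x hxy.symm hx.2 with rfl | rfl
        · exact (hAU' hx.1).2 (Or.inl rfl)
        · exact huA' hx.1
      refine hclosed' x hx.1 y ⟨memU hxy.symm, ?_⟩ (fun h => hc.1 ⟨h, hyA⟩) hxy
      rintro (h | h)
      · exact hc.2 h
      · exact hyA (h ▸ hu'A)) b ⟨hb, hbA⟩ z hbz v u' hvu'
    rcases this with h | h
    · exact (hAU' h.1).2 (Or.inl rfl)
    · exact h.2 hu'A
  exact ih A' (lt_of_le_of_ne hsub fun h => (hAU' (h ▸ hu'A : u' ∈ A')).2 (Or.inr rfl)) u' hA'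

section totalGraph

variable {G : SimpleGraph V}

theorem totalGraph_adj_inl {u v : V} (h : G.Adj u v) : (totalGraph G).Adj (.inl u) (.inl v) :=
  ⟨fun heq => h.ne (Sum.inl_injective heq), Or.inl h⟩

theorem totalGraph_adj_incident {u : V} {e : G.edgeSet} (h : u ∈ (e : Sym2 V)) :
    (totalGraph G).Adj (.inl u) (.inr e) :=
  ⟨Sum.inl_ne_inr, Or.inl h⟩

theorem totalGraph_adj_inr {u : V} {e f : G.edgeSet} (hef : e ≠ f) (he : u ∈ (e : Sym2 V))
    (hf : u ∈ (f : Sym2 V)) : (totalGraph G).Adj (.inr e) (.inr f) :=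
  ⟨fun heq => hef (Sum.inr_injective heq), Or.inl ⟨u, he, hf⟩⟩

theorem Linked.inl_image {S : Set V} (hS : Linked G S) : Linked (totalGraph G) (Sum.inl '' S) := by
  refine ⟨hS.1.image _, fun X hX hne hXS => ?_⟩
  obtain ⟨x, hx, y, hy, hyX, hxy⟩ := hS.2 (Sum.inl ⁻¹' X) (fun x hx => by
    obtain ⟨y, hy, hyx⟩ := hX hx
    exact Sum.inl_injective hyx ▸ hy) (by
    obtain ⟨a, ha⟩ := hne
    obtain ⟨x, hx, rfl⟩ := hX ha
    exact ⟨x, ha⟩) fun h => hXS (Set.Subset.antisymm hX (by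
    rintro _ ⟨x, hx, rfl⟩
    exact (h.symm ▸ hx : x ∈ Sum.inl ⁻¹' X)))
  exact ⟨_, hx, _, ⟨y, hy, rfl⟩, hyX, totalGraph_adj_inl hxy⟩

/-- The edges spanned by a connected set of at least two vertices are connected. -/
theorem Linked.edges {S : Set V} (hS : Linked G S) (hS2 : S.Nontrivial) :
    Linked (totalGraph G) {a | ∃ e : G.edgeSet, a = .inr e ∧ ∀ x ∈ (e : Sym2 V), x ∈ S} := by
  constructor
  · obtain ⟨a, ha, b, hb, hab⟩ := hS2
    obtain ⟨x, hx, y, hy, -, hxy⟩ := hS.2 {a} (Set.singleton_subset_iff.2 ha) ⟨a, rfl⟩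
      fun h => hab (h ▸ hb : b ∈ ({a} : Set V)).symm
    rw [Set.mem_singleton_iff] at hx
    subst hx
    refine ⟨_, ⟨s(x, y), hxy⟩, rfl, fun z hz => ?_⟩
    rcases Sym2.mem_iff.1 hz with rfl | rfl
    · exact ha
    · exact hy
  intro X hX hne hXS
  obtain ⟨Y, hY⟩ : ∃ Y : Set V, ∀ x, x ∈ Y ↔ ∃ e : G.edgeSet, .inr e ∈ X ∧ x ∈ (e : Sym2 V) :=
    ⟨{x | _}, fun x => Iff.rfl⟩
  have hfin : ∀ x ∈ Y, ∀ e : G.edgeSet, x ∈ (e : Sym2 V) → (∀ x ∈ (e : Sym2 V), x ∈ S) →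
      .inr e ∉ X → ∃ a ∈ X, ∃ b ∈ {a | ∃ e : G.edgeSet, a = .inr e ∧ ∀ x ∈ (e : Sym2 V), x ∈ S},
        b ∉ X ∧ (totalGraph G).Adj a b := by
    intro x hx e hxe heS heX
    obtain ⟨f, hf, hxf⟩ := (hY x).1 hx
    exact ⟨_, hf, _, ⟨e, rfl, heS⟩, heX, totalGraph_adj_inr (fun h => heX (h ▸ hf)) hxf hxe⟩
  have hYS : Y ⊆ S := by
    intro x hx
    obtain ⟨e, he, hxe⟩ := (hY x).1 hx
    obtain ⟨f, hf, hfS⟩ := hX he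
    obtain rfl := Sum.inr_injective hf
    exact hfS x hxe
  by_cases hYeq : Y = S
  · obtain ⟨_, ⟨e, rfl, heS⟩, heX⟩ : ∃ b ∈ {a | ∃ e : G.edgeSet, a = .inr e ∧
        ∀ x ∈ (e : Sym2 V), x ∈ S}, b ∉ X := by
      by_contra! hc
      exact hXS (Set.Subset.antisymm hX hc)
    obtain ⟨x, hx⟩ : ∃ x, x ∈ (e : Sym2 V) := by
      obtain ⟨e, he⟩ := e
      induction e with | _ x y => exact ⟨x, Sym2.mem_mk_left x y⟩
    exact hfin x (hYeq ▸ heS x hx) e hx heS heX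
  · obtain ⟨x, hx, y, hy, hyY, hxy⟩ := hS.2 Y hYS (by
      obtain ⟨a, ha⟩ := hne
      obtain ⟨⟨e, he⟩, rfl, -⟩ := hX ha
      induction e with | _ x y =>
      exact ⟨x, (hY x).2 ⟨_, ha, Sym2.mem_mk_left x y⟩⟩) hYeq
    refine hfin x hx ⟨s(x, y), hxy⟩ (Sym2.mem_mk_left x y) (fun z hz => ?_) fun h =>
      hyY ((hY y).2 ⟨_, h, Sym2.mem_mk_right x y⟩)
    rcases Sym2.mem_iff.1 hz with rfl | rfl
    · exact hYS hx
    · exact hy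

theorem hasCliqueMinor_of_clique {W : Type*} {H : SimpleGraph W} {C : Finset W}
    (hC : ∀ a ∈ C, ∀ b ∈ C, a ≠ b → H.Adj a b) {m : ℕ} (Q : Fin m → Set W)
    (hQ : ∀ i, Linked H (Q i))
    (hQQ : ∀ i j, i ≠ j → Disjoint (Q i) (Q j) ∧ ∃ u ∈ Q i, ∃ v ∈ Q j, H.Adj u v)
    (hCQ : ∀ c ∈ C, ∀ i, c ∉ Q i ∧ ∃ q ∈ Q i, H.Adj c q) : HasCliqueMinor H (C.card + m) := by
  have e : Fin (C.card + m) ≃ C ⊕ Fin m := (Fintype.equivFinOfCardEq (by simp)).symm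
  obtain ⟨B, hB₁, hB₂⟩ : ∃ B : C ⊕ Fin m → Set W, (∀ c, B (.inl c) = {(c : W)}) ∧
      ∀ i, B (.inr i) = Q i := ⟨Sum.elim (fun c => {(c : W)}) Q, fun _ => rfl, fun _ => rfl⟩
  have hlink : ∀ i, Linked H (B i) := by
    rintro (c | i)
    · rw [hB₁]
      exact linked_singleton H _
    · rw [hB₂]
      exact hQ i
  have key : ∀ i j, i ≠ j → Disjoint (B i) (B j) ∧ ∃ u ∈ B i, ∃ v ∈ B j, H.Adj u v := by
    rintro (c | i) (d | j) hne
    · rw [hB₁, hB₁]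
      have hcd : (c : W) ≠ d := fun h => hne (congrArg Sum.inl (Subtype.ext h))
      exact ⟨Set.disjoint_singleton.2 hcd, _, rfl, _, rfl, hC _ c.2 _ d.2 hcd⟩
    · rw [hB₁, hB₂]
      obtain ⟨h1, q, hq, h2⟩ := hCQ c c.2 j
      exact ⟨Set.disjoint_singleton_left.2 h1, _, rfl, q, hq, h2⟩
    · rw [hB₁, hB₂]
      obtain ⟨h1, q, hq, h2⟩ := hCQ d d.2 i
      exact ⟨Set.disjoint_singleton_right.2 h1, q, hq, _, rfl, h2.symm⟩
    · rw [hB₂, hB₂]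
      exact hQQ i j fun h => hne (congrArg Sum.inr h)
  exact ⟨fun i => B (e i), fun i => (hlink _).1, fun i j hij => (key _ _ (e.injective.ne hij)).1,
    fun i => (hlink _).induce_connected, fun i j hij => (key _ _ (e.injective.ne hij)).2⟩

theorem exists_star_clique [Fintype V] (G : SimpleGraph V) (v : V) :
    ∃ C : Finset (V ⊕ G.edgeSet), C.card = degIn G Finset.univ v + 1 ∧
      (∀ a ∈ C, ∀ b ∈ C, a ≠ b → (totalGraph G).Adj a b) ∧
      ∀ c ∈ C, c = .inl v ∨ ∃ (x : V) (h : G.Adj v x), c = .inr ⟨s(v, x), h⟩ := by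
  obtain ⟨T, hT⟩ : ∃ T : Finset (V ⊕ G.edgeSet), T = (Finset.univ : Finset {x // G.Adj v x}).image
    fun x => .inr ⟨s(v, x), x.2⟩ := ⟨_, rfl⟩
  have hmem : ∀ c ∈ insert (.inl v) T, c = .inl v ∨ ∃ (x : V) (h : G.Adj v x),
      c = .inr ⟨s(v, x), h⟩ := by
    intro c hc
    rcases Finset.mem_insert.1 hc with rfl | hc
    · exact Or.inl rfl
    · rw [hT, Finset.mem_image] at hc
      obtain ⟨x, -, rfl⟩ := hc
      exact Or.inr ⟨x, x.2, rfl⟩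
  refine ⟨insert (.inl v) T, ?_, fun a ha b hb hab => ?_, hmem⟩
  · rw [Finset.card_insert_of_notMem (by simp [hT]), hT, Finset.card_image_of_injective,
      Finset.card_univ, Fintype.card_subtype, degIn]
    intro x y hxy
    exact Subtype.ext (Sym2.congr_right.1 (congrArg Subtype.val (Sum.inr_injective hxy)))
  · rcases hmem a ha with rfl | ⟨x, hx, rfl⟩ <;> rcases hmem b hb with rfl | ⟨y, hy, rfl⟩
    · exact absurd rfl hab
    · exact totalGraph_adj_incident (Sym2.mem_mk_left _ _)
    · exact (totalGraph_adj_incident (Sym2.mem_mk_left _ _)).symm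
    · exact totalGraph_adj_inr (fun h => hab (congrArg Sum.inr h)) (Sym2.mem_mk_left _ _)
        (Sym2.mem_mk_left _ _)

theorem hasCliqueMinor_degree_add_one [Fintype V] (G : SimpleGraph V) (v : V) :
    HasCliqueMinor (totalGraph G) (degIn G Finset.univ v + 1) := by
  obtain ⟨C, hcard, hC, -⟩ := exists_star_clique G v
  rw [← hcard]
  exact hasCliqueMinor_of_clique hC (m := 0) (fun i => i.elim0) (fun i => i.elim0)
    (fun i => i.elim0) fun _ _ i => i.elim0

theorem hasCliqueMinor_degree_add_two [Fintype V] {v : V} {S : Set V} (hS : Linked G S)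
    (hvS : v ∉ S) (hv : ∃ x, G.Adj v x) (hN : ∀ x, G.Adj v x → x ∈ S) :
    HasCliqueMinor (totalGraph G) (degIn G Finset.univ v + 2) := by
  obtain ⟨C, hcard, hC, hmem⟩ := exists_star_clique G v
  rw [show degIn G Finset.univ v + 2 = C.card + 1 by omega]
  refine hasCliqueMinor_of_clique hC (fun _ => Sum.inl '' S) (fun _ => hS.inl_image)
    (fun i j hij => absurd (Subsingleton.elim i j) hij) fun c hc _ => ?_
  rcases hmem c hc with rfl | ⟨x, hx, rfl⟩
  · obtain ⟨x, hx⟩ := hv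
    refine ⟨?_, _, ⟨x, hN x hx, rfl⟩, totalGraph_adj_inl hx⟩
    rintro ⟨y, hy, hyv⟩
    exact hvS (Sum.inl_injective hyv ▸ hy)
  · refine ⟨?_, _, ⟨x, hN x hx, rfl⟩, (totalGraph_adj_incident (Sym2.mem_mk_right _ _)).symm⟩
    rintro ⟨y, hy, hyv⟩
    exact Sum.inl_ne_inr hyv

theorem exists_adj_ne_ne [Fintype V] {x : V} (hx : 3 ≤ degIn G Finset.univ x) (a b : V) :
    ∃ y, G.Adj x y ∧ y ≠ a ∧ y ≠ b := by
  obtain ⟨y, hy, hyab⟩ := Finset.exists_mem_notMem_of_card_lt_card (s := {a, b})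
    (t := Finset.univ.filter fun y => G.Adj x y) (Finset.card_le_two.trans_lt hx)
  rw [Finset.mem_insert, Finset.mem_singleton, not_or] at hyab
  exact ⟨y, (Finset.mem_filter.1 hy).2, hyab⟩

theorem hasCliqueMinor_degree_add_three [Fintype V] {v u : V} (hvu : G.Adj v u)
    (hdeg : ∀ x y, G.Adj x y → 3 ≤ degIn G Finset.univ x)
    (hS : Linked G ({x | ∃ y, G.Adj x y} \ {v, u})) :
    HasCliqueMinor (totalGraph G) (degIn G Finset.univ v + 3) := by
  obtain ⟨S, hSdef⟩ : ∃ S, S = {x | ∃ y, G.Adj x y} \ {v, u} := ⟨_, rfl⟩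
  rw [← hSdef] at hS
  have memS : ∀ {x y}, G.Adj x y → x ≠ v → x ≠ u → x ∈ S := fun {x y} h h1 h2 =>
    hSdef ▸ ⟨⟨y, h⟩, fun h => h.elim h1 h2⟩
  have hvS : v ∉ S := hSdef ▸ fun h => h.2 (Or.inl rfl)
  have huS : u ∉ S := hSdef ▸ fun h => h.2 (Or.inr rfl)
  have hSdeg : ∀ x ∈ S, 3 ≤ degIn G Finset.univ x := by
    intro x hx
    rw [hSdef] at hx
    obtain ⟨y, hy⟩ := hx.1
    exact hdeg x y hy
  obtain ⟨w, huw, hwv, -⟩ := exists_adj_ne_ne (hdeg u v hvu.symm) v v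
  have hwS : w ∈ S := memS huw.symm hwv huw.ne.symm
  obtain ⟨C, hcard, hC, hmem⟩ := exists_star_clique G v
  let e₀ : G.edgeSet := ⟨s(u, w), huw⟩
  obtain ⟨P, hP⟩ : ∃ P : Set (V ⊕ G.edgeSet), P = insert (.inr e₀) (Sum.inl '' S) := ⟨_, rfl⟩
  obtain ⟨Q, hQ⟩ : ∃ Q : Set (V ⊕ G.edgeSet), Q = insert (.inl u)
      {a | ∃ e : G.edgeSet, a = .inr e ∧ v ∉ (e : Sym2 V) ∧ e ≠ e₀} := ⟨_, rfl⟩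
  have hQe : ∀ x y (hxy : G.Adj x y), x ≠ v → y ≠ v → s(x, y) ≠ s(u, w) →
      .inr ⟨s(x, y), hxy⟩ ∈ Q := by
    intro x y hxy h1 h2 h3
    rw [hQ]
    refine Or.inr ⟨_, rfl, fun h => ?_, fun h => h3 (congrArg Subtype.val h)⟩
    rcases Sym2.mem_iff.1 h with h | h
    · exact h1 h.symm
    · exact h2 h.symm
  have hPl : Linked (totalGraph G) P := by
    refine hS.inl_image.of_dominating (hP ▸ Set.subset_insert _ _) fun b hb hbS => ?_
    rw [hP] at hb
    obtain rfl := hb.resolve_right hbS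
    exact ⟨_, ⟨w, hwS, rfl⟩, (totalGraph_adj_incident (Sym2.mem_mk_right u w)).symm⟩
  have hQl : Linked (totalGraph G) Q := by
    have hS2 : S.Nontrivial := by
      obtain ⟨y, hy, h1, h2⟩ := exists_adj_ne_ne (hSdeg w hwS) v u
      exact ⟨w, hwS, y, memS hy.symm h1 h2, hy.ne⟩
    have h1 : Linked (totalGraph G) {a | ∃ e : G.edgeSet, a = .inr e ∧ v ∉ (e : Sym2 V) ∧ e ≠ e₀} := by
      refine (hS.edges hS2).of_dominating ?_ ?_
      · rintro _ ⟨e, rfl, he⟩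
        refine ⟨e, rfl, fun h => hvS (he v h), ?_⟩
        rintro rfl
        exact huS (he u (Sym2.mem_mk_left u w))
      · rintro _ ⟨⟨e, he⟩, rfl, hve, hne⟩ heS
        obtain ⟨x, hxS, hxe⟩ : ∃ x ∈ S, x ∈ e := by
          induction e with | _ x y =>
          by_cases hx : x = u
          · exact ⟨y, memS (SimpleGraph.Adj.symm he) (fun h => hve (h ▸ Sym2.mem_mk_right _ _))
              (hx ▸ (SimpleGraph.Adj.ne he).symm), Sym2.mem_mk_right _ _⟩
          · exact ⟨x, memS he (fun h => hve (h ▸ Sym2.mem_mk_left _ _)) hx, Sym2.mem_mk_left _ _⟩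
        obtain ⟨y, hxy, hy1, hy2⟩ := exists_adj_ne_ne (hSdeg x hxS) v u
        have hmemS : ∀ z ∈ s(x, y), z ∈ S := by
          intro z hz
          rcases Sym2.mem_iff.1 hz with rfl | rfl
          · exact hxS
          · exact memS hxy.symm hy1 hy2
        refine ⟨_, ⟨⟨s(x, y), hxy⟩, rfl, hmemS⟩, totalGraph_adj_inr (fun h => heS ?_) hxe
          (Sym2.mem_mk_left x y)⟩
        exact ⟨_, rfl, congrArg Subtype.val h ▸ hmemS⟩
    refine h1.of_dominating (hQ ▸ Set.subset_insert _ _) fun b hb hbS => ?_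
    rw [hQ] at hb
    obtain rfl := hb.resolve_right hbS
    obtain ⟨y, huy, hy1, hy2⟩ := exists_adj_ne_ne (hdeg u v hvu.symm) v w
    refine ⟨_, ⟨⟨s(u, y), huy⟩, rfl, fun h => ?_, fun h => ?_⟩,
      totalGraph_adj_incident (Sym2.mem_mk_left u y)⟩
    · rcases Sym2.mem_iff.1 h with h | h
      · exact hvu.ne h
      · exact hy1 h.symm
    · exact hy2 (Sym2.congr_right.1 (congrArg Subtype.val h))
  have hPQ : Disjoint P Q := by
    rw [Set.disjoint_left, hP, hQ]
    rintro a (rfl | ⟨x, hx, rfl⟩) (h | ⟨e, he, h1, h2⟩)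
    · exact Sum.inr_ne_inl h
    · exact h2 (Sum.inr_injective he).symm
    · exact huS (Sum.inl_injective h ▸ hx)
    · exact Sum.inl_ne_inr he
  have hPQa : ∃ p ∈ P, ∃ q ∈ Q, (totalGraph G).Adj p q :=
    ⟨.inl w, hP ▸ Or.inr ⟨w, hwS, rfl⟩, .inl u, hQ ▸ Or.inl rfl, totalGraph_adj_inl huw.symm⟩
  have hCP : ∀ c ∈ C, c ∉ P ∧ ∃ q ∈ P, (totalGraph G).Adj c q := by
    intro c hc
    rcases hmem c hc with rfl | ⟨x, hx, rfl⟩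
    · obtain ⟨y, hvy, hy, -⟩ := exists_adj_ne_ne (hdeg v u hvu) u u
      refine ⟨?_, .inl y, hP ▸ Or.inr ⟨y, memS hvy.symm hvy.ne.symm hy, rfl⟩,
        totalGraph_adj_inl hvy⟩
      rw [hP]
      rintro (h | ⟨y, hy, h⟩)
      · exact Sum.inl_ne_inr h
      · exact hvS (Sum.inl_injective h ▸ hy)
    · have hne : (⟨s(v, x), hx⟩ : G.edgeSet) ≠ e₀ := by
        intro h
        have heq : s(v, x) = s(u, w) := congrArg Subtype.val h
        have : v ∈ s(u, w) := heq ▸ Sym2.mem_mk_left v x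
        rcases Sym2.mem_iff.1 this with h | h
        · exact hvu.ne h
        · exact hwv h.symm
      refine ⟨?_, ?_⟩
      · rw [hP]
        rintro (h | ⟨y, hy, h⟩)
        · exact hne (Sum.inr_injective h)
        · exact Sum.inl_ne_inr h
      · by_cases hxu : x = u
        · subst hxu
          exact ⟨.inr e₀, hP ▸ Or.inl rfl, totalGraph_adj_inr hne (Sym2.mem_mk_right _ _)
            (Sym2.mem_mk_left x w)⟩
        · exact ⟨.inl x, hP ▸ Or.inr ⟨x, memS hx.symm hx.ne.symm hxu, rfl⟩,
            (totalGraph_adj_incident (Sym2.mem_mk_right _ _)).symm⟩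
  have hCQ : ∀ c ∈ C, c ∉ Q ∧ ∃ q ∈ Q, (totalGraph G).Adj c q := by
    intro c hc
    rcases hmem c hc with rfl | ⟨x, hx, rfl⟩
    · refine ⟨?_, .inl u, hQ ▸ Or.inl rfl, totalGraph_adj_inl hvu⟩
      rw [hQ]
      rintro (h | ⟨e, he, -⟩)
      · exact hvu.ne (Sum.inl_injective h)
      · exact Sum.inl_ne_inr he
    · refine ⟨?_, ?_⟩
      · rw [hQ]
        rintro (h | ⟨e, he, h, -⟩)
        · exact Sum.inr_ne_inl h
        · exact h (Sum.inr_injective he ▸ Sym2.mem_mk_left v x)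
      · by_cases hxu : x = u
        · subst hxu
          exact ⟨.inl x, hQ ▸ Or.inl rfl, (totalGraph_adj_incident (Sym2.mem_mk_right v x)).symm⟩
        · obtain ⟨y, hxy, hy1, hy2⟩ := exists_adj_ne_ne (hdeg x v hx.symm) v u
          refine ⟨_, hQe x y hxy hx.ne.symm hy1 fun h => ?_, totalGraph_adj_inr (fun h => ?_)
            (Sym2.mem_mk_right v x) (Sym2.mem_mk_left x y)⟩
          · have : u ∈ s(x, y) := h ▸ Sym2.mem_mk_left u w
            rcases Sym2.mem_iff.1 this with h | h
            · exact hxu h.symm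
            · exact hy2 h.symm
          · have heq : s(v, x) = s(x, y) := congrArg Subtype.val h
            have : v ∈ s(x, y) := heq ▸ Sym2.mem_mk_left v x
            rcases Sym2.mem_iff.1 this with h | h
            · exact hx.ne h
            · exact hy1 h.symm
  rw [show degIn G Finset.univ v + 3 = C.card + 2 by omega]
  refine hasCliqueMinor_of_clique hC ![P, Q] (fun i => ?_) (fun i j hij => ?_) fun c hc i => ?_
  · fin_cases i
    exacts [hPl, hQl]
  · fin_cases i <;> fin_cases j
    · exact absurd rfl hij
    · exact ⟨hPQ, hPQa⟩
    · obtain ⟨p, hp, q, hq, hpq⟩ := hPQa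
      exact ⟨hPQ.symm, q, hq, p, hp, hpq.symm⟩
    · exact absurd rfl hij
  · fin_cases i
    exacts [hCP c hc, hCQ c hc]

end totalGraph

theorem HasCliqueMinor.of_hom {W W' : Type*} {H : SimpleGraph W} {H' : SimpleGraph W'} {t : ℕ}
    (f : H →g H') (hf : Function.Injective f) (h : HasCliqueMinor H t) : HasCliqueMinor H' t := by
  obtain ⟨B, h1, h2, h3, h4⟩ := h
  refine ⟨fun i => f '' B i, fun i => (h1 i).image _, fun i j hij =>
    (Set.disjoint_image_iff hf).2 (h2 hij), fun i => ?_, fun i j hij => ?_⟩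
  · let g : H.induce (B i) →g H'.induce (f '' B i) :=
      { toFun := fun x => ⟨f x, x, x.2, rfl⟩
        map_rel' := fun h => f.map_rel h }
    refine (h3 i).map g ?_
    rintro ⟨_, x, hx, rfl⟩
    exact ⟨⟨x, hx⟩, rfl⟩
  · obtain ⟨u, hu, v, hv, huv⟩ := h4 hij
    exact ⟨_, ⟨u, hu, rfl⟩, _, ⟨v, hv, rfl⟩, f.map_rel huv⟩

theorem HasCliqueMinor.totalGraph_mono {G H : SimpleGraph V} (hGH : G ≤ H) {t : ℕ}
    (h : HasCliqueMinor (totalGraph G) t) : HasCliqueMinor (totalGraph H) t := by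
  have hinj : Function.Injective
      (Sum.map id (Set.inclusion (SimpleGraph.edgeSet_mono hGH)) : V ⊕ G.edgeSet → V ⊕ H.edgeSet) :=
    Function.Injective.sumMap Function.injective_id (Set.inclusion_injective _)
  refine h.of_hom ⟨_, fun {a b} hab => ?_⟩ hinj
  refine ⟨fun heq => hab.1 (hinj heq), ?_⟩
  have := hab.2
  rcases a with a | ⟨e, he⟩ <;> rcases b with b | ⟨f, hf⟩
  · exact this.imp (fun h => hGH h) fun h => hGH h
  · exact this
  · exact this
  · exact this

theorem HasCliqueMinor.le_card {W : Type*} [Fintype W] {H : SimpleGraph W} {t : ℕ}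
    (h : HasCliqueMinor H t) : t ≤ Fintype.card W := by
  obtain ⟨B, h1, h2, -⟩ := h
  choose b hb using h1
  have : Function.Injective b := by
    intro i j hij
    by_contra hne
    exact Set.disjoint_left.1 (h2 hne) (hb i) (hij ▸ hb j)
  simpa using Fintype.card_le_of_injective b this

theorem HasCliqueMinor.le_hadwigerNumber {W : Type*} [Finite W] {H : SimpleGraph W} {t : ℕ}
    (h : HasCliqueMinor H t) : t ≤ hadwigerNumber H := by
  have := Fintype.ofFinite W
  exact le_csSup ⟨Fintype.card W, fun _ => HasCliqueMinor.le_card⟩ h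

theorem TotalColorable.colorable_totalGraph {G : SimpleGraph V} {k : ℕ} (h : TotalColorable G k) :
    (totalGraph G).Colorable k := by
  obtain ⟨cv, ce, ⟨h1, h2, h3⟩, hcv, hce⟩ := h
  have hev : ∀ u e, e ∈ G.edgeSet → u ∈ e → ce e ≠ cv u := by
    rintro u e he ⟨x, rfl⟩
    exact (h3 he).1
  have hee : ∀ u e f, e ∈ G.edgeSet → f ∈ G.edgeSet → u ∈ e → u ∈ f → e ≠ f → ce e ≠ ce f := by
    rintro u e f he hf ⟨x, rfl⟩ ⟨y, rfl⟩ hne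
    exact h2 he hf fun h => hne (congrArg (fun z => s(u, z)) h)
  refine ⟨SimpleGraph.Coloring.mk (Sum.elim (fun v => ⟨cv v, hcv v⟩) fun e => ⟨ce e, hce e e.2⟩) ?_⟩
  rintro (a | ⟨e, he⟩) (b | ⟨f, hf⟩) ⟨hne, hab⟩ heq <;> have heq' := congrArg Fin.val heq
  · exact hab.elim (fun h => h1 h heq') fun h => h1 h heq'.symm
  · exact hev a f hf (hab.elim id id) heq'.symm
  · exact hev b e he (hab.elim id id) heq'
  · have hef : e ≠ f := fun h => hne (congrArg Sum.inr (Subtype.ext h))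
    rcases hab with ⟨u, hu, hu'⟩ | ⟨u, hu', hu⟩ <;> exact hee u e f he hf hu hu' hef heq'

theorem totalColorable_of_hasCliqueMinor_le [Fintype V] (G : SimpleGraph V) {k : ℕ}
    (φ : V → Fin 5) (hφ : ∀ ⦃x y⦄, G.Adj x y → φ x ≠ φ y)
    (hk : ∀ t, HasCliqueMinor (totalGraph G) t → t ≤ k) : TotalColorable G k := by
  induction G using WellFoundedLT.induction with
  | _ G ih =>
  have ih' : ∀ G' < G, TotalColorable G' k := fun G' hG' =>
    ih G' hG' (fun x y h => hφ (hG'.le h)) fun t ht => hk t (ht.totalGraph_mono hG'.le)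
  have hdeg : ∀ v, degIn G Finset.univ v < k := fun v => hk _ (hasCliqueMinor_degree_add_one G v)
  by_contra hcon
  have hsplit := unsplittable_of_not_totalColorable hdeg ih' hcon
  obtain ⟨x, y, hxy⟩ : ∃ x y, G.Adj x y := by
    by_contra! h0
    exact hcon ⟨fun _ => 0, fun _ => 0, ⟨fun u v h => absurd h (h0 u v),
      fun u v _ h => absurd h (h0 u v), fun u v h => absurd h (h0 u v)⟩,
      fun v => (Nat.zero_le _).trans_lt (hdeg v), fun e he => by
        induction e with | _ u v => exact absurd he (h0 u v)⟩
  obtain ⟨v, -, hv⟩ := Finset.exists_max_image Finset.univ (degIn G Finset.univ) ⟨x, Finset.mem_univ x⟩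
  replace hv := fun u => hv u (Finset.mem_univ u)
  have hpos : ∀ a b, G.Adj a b → 2 ≤ degIn G Finset.univ a := by
    intro a b hab
    by_contra hlt
    have hcard := card_filter_adj_ne hab
    have h3 := hk _ (hasCliqueMinor_degree_add_two (linked_singleton G b) hab.ne ⟨b, hab⟩
      fun c hac => by
        by_contra hcb
        have hc : c ∈ Finset.univ.filter fun x => G.Adj a x ∧ x ≠ b :=
          Finset.mem_filter.2 ⟨Finset.mem_univ c, hac, hcb⟩
        have := Finset.card_pos.2 ⟨c, hc⟩
        omega)
    have := hdeg b
    exact hcon ((ih' _ (deleteEdges_lt hab)).of_deleteEdges hab (by omega) (by omega))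
  have hv2 : 2 ≤ degIn G Finset.univ v := (hpos x y hxy).trans (hv x)
  obtain ⟨u, hu⟩ := Finset.card_pos.1 (zero_lt_two.trans_le hv2)
  have hvu := (Finset.mem_filter.1 hu).2
  have hk2 := hk _ (hasCliqueMinor_degree_add_two
    (hsplit.linked ⟨u, ⟨v, hvu.symm⟩, hvu.ne.symm⟩) (fun h => h.2 rfl) ⟨u, hvu⟩
    fun x hvx => ⟨⟨v, hvx.symm⟩, hvx.ne.symm⟩)
  rcases Nat.lt_or_ge 2 (degIn G Finset.univ v) with hv3 | hv3
  · have hdeg3 : ∀ a b, G.Adj a b → 3 ≤ degIn G Finset.univ a := by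
      intro a b hab
      by_contra hlt
      have := hpos a b hab
      have := hv b
      exact hcon ((ih' _ (deleteEdges_lt hab)).of_deleteEdges hab (by omega) (by omega))
    obtain ⟨u', hvu', hlinked⟩ := hsplit.exists_linked ⟨u, hvu⟩ fun u hvu => by
      obtain ⟨w, hvw, hwu, -⟩ := exists_adj_ne_ne hv3 u u
      exact ⟨w, ⟨v, hvw.symm⟩, fun h => h.elim hvw.ne.symm hwu⟩
    have hk3 := hk _ (hasCliqueMinor_degree_add_three hvu' hdeg3 hlinked)
    exact hcon ((totalColorable_of_five_coloring G hv2 hv φ hφ).mono hk3)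
  · exact hcon ((totalColorable_four G fun w => (hv w).trans hv3).mono (by omega))

theorem chromaticNumber_totalGraph_le_hadwigerNumber [Fintype V] (G : SimpleGraph V)
    (hG : ¬ HasMinor G (⊤ : SimpleGraph (Fin 5))) :
    (totalGraph G).chromaticNumber ≤ (hadwigerNumber (totalGraph G) : ℕ∞) := by
  obtain ⟨φ, hφ⟩ := exists_five_coloring hG
  exact (totalColorable_of_hasCliqueMinor_le G φ hφ fun _ =>
    HasCliqueMinor.le_hadwigerNumber).colorable_totalGraph.chromaticNumber_le

end

/-- Hadwiger's conjecture holds for the total graph of every planar simple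
finite graph: `χ(T(G)) ≤ η(T(G))`. -/
theorem hadwiger_totalGraph_of_planar {V : Type*} [Fintype V] (G : SimpleGraph V)
    (hplanar : IsPlanar G) :
    (totalGraph G).chromaticNumber ≤ (hadwigerNumber (totalGraph G) : ℕ∞) :=
  chromaticNumber_totalGraph_le_hadwigerNumber G hplanar.1
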